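/- Let s ∈ ℂ with Re(s) > −1. For z ∈ ℂ and an integer n ≥ 0, let w_n(z) denote the n-th approximant of the continued fraction with partial numerators a₁ = 1 and a_j = (j−1)² for j ≥ 2, and partial denominators b_j = z − (2j−1); explicitly, w_0 = 0 and w_n(z) = 1/(z−1 − 1/(z−3 − 4/(z−5 − 9/(⋯ − (n−1)²/(z−(2n−1)))))). Then for every integer n ≥ 0, x^{−(s+1)}·∑_{p ≤ x} p^s − w_n((s+1)·log x) ∼ (n!)²/((s+1)·log x)^{2n+1} as x → ∞ (x real). -/

import Mathlib

open Filter

/-- `π_s(x) = ∑_{p ≤ x} p^s`, the sum over primes `p ≤ x`. -/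
noncomputable def piPow (s : ℂ) (x : ℝ) : ℂ :=
  ∑ p ∈ (⌊x⌋₊ + 1).primesBelow, (p : ℂ) ^ s

/-- `cfApproxC a b j n` is the `n`-th approximant of the continued fraction
`a_j/(b_j − a_{j+1}/(b_{j+1} − ⋯))`; the `0`-th approximant is `0`. -/
noncomputable def cfApproxC (a b : ℕ → ℂ) : ℕ → ℕ → ℂ
  | _, 0 => 0
  | j, n + 1 => a j / (b j - cfApproxC a b (j + 1) n)

/-- The Euler–Maclaurin remainder `(a+1)^{-s} - ∫_a^{a+1} u^{-s} du`. -/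
noncomputable def zetaRem (a : ℝ) (s : ℂ) : ℂ :=
  ((a + 1 : ℝ) : ℂ) ^ (-s) + (((a + 1 : ℝ) : ℂ) ^ (1 - s) - (a : ℂ) ^ (1 - s)) / (s - 1)

theorem norm_cpow_sub_cpow_le {a u v : ℝ} {s : ℂ} (ha : 0 < a) (hs : 0 < s.re)
    (hu : u ∈ Set.Icc a (a + 1)) (hv : v ∈ Set.Icc a (a + 1)) :
    ‖(u : ℂ) ^ (-s) - (v : ℂ) ^ (-s)‖ ≤ ‖s‖ * a ^ (-s.re - 1) := by
  have hs0 : s ≠ 0 := by rintro rfl; simp at hs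
  have key := Convex.norm_image_sub_le_of_norm_hasDerivWithin_le (𝕜 := ℝ)
    (f := fun y : ℝ => (y : ℂ) ^ (-s)) (f' := fun y : ℝ => (-s) * (y : ℂ) ^ (-s - 1))
    (s := Set.Icc a (a + 1)) (x := v) (y := u) (C := ‖s‖ * a ^ (-s.re - 1)) ?_ ?_
    (convex_Icc _ _) hv hu
  · refine key.trans (mul_le_of_le_one_right (by positivity) ?_)
    rw [Real.norm_eq_abs, abs_le]
    constructor <;> linarith [hu.1, hu.2, hv.1, hv.2]
  · intro y hy
    have hy0 : y ≠ 0 := (ha.trans_le hy.1).ne'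
    exact (hasDerivAt_ofReal_cpow_const hy0 (neg_ne_zero.2 hs0)).hasDerivWithinAt
  · intro y hy
    have hy0 : 0 < y := ha.trans_le hy.1
    rw [norm_mul, norm_neg, Complex.norm_cpow_eq_rpow_re_of_pos hy0]
    gcongr
    simp only [Complex.sub_re, Complex.neg_re, Complex.one_re]
    exact Real.rpow_le_rpow_of_nonpos ha hy.1 (by linarith)

theorem norm_zetaRem_le {a : ℝ} {s : ℂ} (ha : 0 < a) (hs : 0 < s.re) (hs1 : s ≠ 1) :
    ‖zetaRem a s‖ ≤ ‖s‖ * a ^ (-s.re - 1) := by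
  have hs1' : s - 1 ≠ 0 := sub_ne_zero.2 hs1
  have hs2 : -s + 1 ≠ 0 := by intro h; apply hs1'; linear_combination -h
  have ha1 : a + 1 ∈ Set.Icc a (a + 1) := ⟨by linarith, le_rfl⟩
  have key := Convex.norm_image_sub_le_of_norm_hasDerivWithin_le (𝕜 := ℝ)
    (f := fun y : ℝ => (y : ℂ) ^ (-s + 1) / (-s + 1) - (y : ℂ) * ((a + 1 : ℝ) : ℂ) ^ (-s))
    (f' := fun y : ℝ => (y : ℂ) ^ (-s) - ((a + 1 : ℝ) : ℂ) ^ (-s))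
    (s := Set.Icc a (a + 1)) (x := a) (y := a + 1) (C := ‖s‖ * a ^ (-s.re - 1)) ?_ ?_
    (convex_Icc _ _) ⟨le_rfl, by linarith⟩ ha1
  · simp only [add_sub_cancel_left, norm_one, mul_one] at key
    refine le_trans (le_of_eq ?_) key
    rw [← norm_neg, zetaRem]
    congr 1
    have e : (1 - s) = -s + 1 := by ring
    rw [e]
    push_cast
    field_simp
    ring
  · intro y hy
    have hy0 : y ≠ 0 := (ha.trans_le hy.1).ne'
    have h := ((hasDerivAt_ofReal_cpow_const hy0 hs2).div_const (-s + 1)).fun_sub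
      ((Complex.ofRealCLM.hasDerivAt (x := y)).mul_const (((a + 1 : ℝ) : ℂ) ^ (-s)))
    have e : -s + 1 - 1 = -s := by ring
    rw [mul_div_cancel_left₀ _ hs2, e] at h
    simpa using h.hasDerivWithinAt
  · intro y hy
    exact norm_cpow_sub_cpow_le ha hs hy ha1

theorem sum_range_zetaRem (s : ℂ) (N M : ℕ) :
    ∑ n ∈ Finset.range M, zetaRem ((N + n : ℕ) : ℝ) s =
      ∑ n ∈ Finset.range M, ((N + n + 1 : ℕ) : ℂ) ^ (-s) +
        (((N + M : ℕ) : ℂ) ^ (1 - s) - (N : ℂ) ^ (1 - s)) / (s - 1) := by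
  have := Finset.sum_range_sub (fun n : ℕ => ((N + n : ℕ) : ℂ) ^ (1 - s) / (s - 1)) M
  simp only [add_zero] at this
  rw [sub_div, ← this, ← Finset.sum_add_distrib]
  refine Finset.sum_congr rfl fun n _ => ?_
  rw [zetaRem, sub_div]
  push_cast
  ring_nf

theorem summable_add_rpow (N : ℕ) {p : ℝ} (hp : p < -1) :
    Summable fun n : ℕ => ((N + n : ℕ) : ℝ) ^ p := by
  have := (summable_nat_add_iff N).2 (Real.summable_nat_rpow.2 hp)
  refine this.congr fun n => ?_
  rw [add_comm]

theorem hasSum_zetaRem {s : ℂ} (hs : 1 < s.re) (N : ℕ) (hN : 0 < N) :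
    HasSum (fun n : ℕ => zetaRem ((N + n : ℕ) : ℝ) s)
      (riemannZeta s - ∑ n ∈ Finset.range N, ((n + 1 : ℕ) : ℂ) ^ (-s)
        - (N : ℂ) ^ (1 - s) / (s - 1)) := by
  have hs1 : s ≠ 1 := by rintro rfl; simp at hs
  have hsum : Summable fun n : ℕ => ((n + 1 : ℕ) : ℂ) ^ (-s) := by
    have := (summable_nat_add_iff 1).2 (Complex.summable_one_div_nat_cpow.2 hs)
    refine this.congr fun n => ?_
    rw [Complex.cpow_neg, one_div]
  have hz : HasSum (fun n : ℕ => ((n + 1 : ℕ) : ℂ) ^ (-s)) (riemannZeta s) := by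
    have h := hsum.hasSum
    convert h using 1
    rw [zeta_eq_tsum_one_div_nat_add_one_cpow hs]
    refine tsum_congr fun n => ?_
    rw [Complex.cpow_neg, one_div]; push_cast; rfl
  have hrem : Summable fun n : ℕ => zetaRem ((N + n : ℕ) : ℝ) s := by
    refine Summable.of_norm_bounded (g := fun n : ℕ => ‖s‖ * ((N + n : ℕ) : ℝ) ^ (-s.re - 1)) ?_
      fun n => norm_zetaRem_le (by positivity) (by linarith) hs1
    refine Summable.mul_left _ ?_
    exact summable_add_rpow N (by linarith)
  refine (Summable.hasSum_iff_tendsto_nat hrem).2 ?_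
  simp_rw [sum_range_zetaRem s N]
  have h1 : Tendsto (fun M : ℕ => ∑ n ∈ Finset.range M, ((N + n + 1 : ℕ) : ℂ) ^ (-s)) atTop
      (nhds (riemannZeta s - ∑ n ∈ Finset.range N, ((n + 1 : ℕ) : ℂ) ^ (-s))) := by
    have := ((hasSum_nat_add_iff' N).2 hz).tendsto_sum_nat
    refine this.congr fun M => Finset.sum_congr rfl fun n _ => ?_
    rw [add_comm n N]
  have h2 : Tendsto (fun M : ℕ => ((N + M : ℕ) : ℂ) ^ (1 - s)) atTop (nhds 0) := by
    rw [tendsto_zero_iff_norm_tendsto_zero]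
    have : Tendsto (fun M : ℕ => ((N + M : ℕ) : ℝ) ^ (-(s.re - 1))) atTop (nhds 0) :=
      (tendsto_rpow_neg_atTop (by linarith)).comp
        (tendsto_natCast_atTop_atTop.comp
          (tendsto_atTop_mono (fun M => Nat.le_add_left M N) tendsto_id))
    refine this.congr fun M => ?_
    rw [Complex.norm_natCast_cpow_of_pos (by omega)]
    simp
  have h3 := h1.add ((h2.sub_const ((N : ℂ) ^ (1 - s))).div_const (s - 1))
  convert h3 using 2
  ring

theorem differentiableAt_zetaRem {a : ℝ} (ha : 0 < a) {s : ℂ} (hs : s ≠ 1) :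
    DifferentiableAt ℂ (zetaRem a) s := by
  have h1 : (a : ℂ) ≠ 0 := by exact_mod_cast ha.ne'
  have h2 : ((a + 1 : ℝ) : ℂ) ≠ 0 := by exact_mod_cast (by positivity : a + 1 ≠ 0)
  have h3 : s - 1 ≠ 0 := sub_ne_zero.2 hs
  unfold zetaRem
  refine DifferentiableAt.add ?_ (DifferentiableAt.div (DifferentiableAt.sub ?_ ?_) ?_ h3)
  · exact DifferentiableAt.const_cpow (by fun_prop) (Or.inl h2)
  · exact DifferentiableAt.const_cpow (by fun_prop) (Or.inl h2)
  · exact DifferentiableAt.const_cpow (by fun_prop) (Or.inl h1)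
  · fun_prop

theorem riemannZeta_eq_sum_add_tsum_zetaRem {s : ℂ} (hs : 1 / 2 < s.re) {c : ℝ}
    (hc : 1 / 2 < c * s.im) (N : ℕ) (hN : 0 < N) :
    riemannZeta s = ∑ n ∈ Finset.range N, ((n + 1 : ℕ) : ℂ) ^ (-s)
        + (N : ℂ) ^ (1 - s) / (s - 1) + ∑' n : ℕ, zetaRem ((N + n : ℕ) : ℝ) s := by
  set R : ℝ := ‖s‖ + 2 with hR
  set U : Set ℂ := ({z : ℂ | 1 / 2 < z.re} ∩ {z : ℂ | 1 / 2 < c * z.im}) ∩ Metric.ball 0 R with hU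
  have hone : ∀ z ∈ U, z ≠ 1 := by
    rintro z ⟨⟨_, hz⟩, _⟩ rfl
    norm_num at hz
  have hUo : IsOpen U :=
    ((isOpen_lt continuous_const Complex.continuous_re).inter
      (isOpen_lt continuous_const (continuous_const.mul Complex.continuous_im))).inter
      Metric.isOpen_ball
  have hUc : Convex ℝ U := by
    refine Convex.inter (Convex.inter ?_ ?_) (convex_ball _ _)
    · exact convex_halfSpace_re_gt _
    · exact convex_halfSpace_gt (f := fun z : ℂ => c * z.im)
        ⟨fun x y => by simp [mul_add], fun a x => by simp; ring⟩ _
  have hsU : s ∈ U := ⟨⟨hs, hc⟩, by simp [hR]⟩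
  set w : ℂ := s + 1 with hw
  have hwU : w ∈ U := by
    refine ⟨⟨?_, ?_⟩, ?_⟩
    · simp only [Set.mem_ofPred_eq, hw, Complex.add_re, Complex.one_re]; linarith
    · simpa [hw] using hc
    · simp only [mem_ball_zero_iff, hw, hR]
      refine (norm_add_le _ _).trans_lt ?_
      simp
  have hf : AnalyticOnNhd ℂ riemannZeta U :=
    DifferentiableOn.analyticOnNhd
      (fun z hz => (differentiableAt_riemannZeta (hone z hz)).differentiableWithinAt) hUo
  have hg : AnalyticOnNhd ℂ (fun s : ℂ => ∑ n ∈ Finset.range N, ((n + 1 : ℕ) : ℂ) ^ (-s)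
        + (N : ℂ) ^ (1 - s) / (s - 1) + ∑' n : ℕ, zetaRem ((N + n : ℕ) : ℝ) s) U := by
    refine DifferentiableOn.analyticOnNhd (DifferentiableOn.add (DifferentiableOn.add ?_ ?_) ?_) hUo
    · refine DifferentiableOn.fun_sum fun n _ z _ => ?_
      exact (DifferentiableAt.const_cpow (by fun_prop)
        (Or.inl (by exact_mod_cast n.succ_ne_zero))).differentiableWithinAt
    · intro z hz
      have hN' : (N : ℂ) ≠ 0 := by exact_mod_cast hN.ne'
      have h1 : DifferentiableAt ℂ (fun z : ℂ => (N : ℂ) ^ (1 - z)) z :=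
        DifferentiableAt.const_cpow (by fun_prop) (Or.inl hN')
      exact (h1.div (differentiableAt_id.sub_const 1)
        (sub_ne_zero.2 (hone z hz))).differentiableWithinAt
    · refine Complex.differentiableOn_tsum_of_summable_norm
        (u := fun n : ℕ => R * ((N + n : ℕ) : ℝ) ^ (-(3 / 2) : ℝ))
        ((summable_add_rpow N (by norm_num)).mul_left _) (fun n z hz =>
          (differentiableAt_zetaRem (by positivity) (hone z hz)).differentiableWithinAt) hUo ?_
      intro n z hz
      have hzr : 1 / 2 < z.re := hz.1.1
      refine (norm_zetaRem_le (by positivity) (by linarith) (hone z hz)).trans ?_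
      have : ‖z‖ ≤ R := by simpa using (mem_ball_zero_iff.1 hz.2).le
      gcongr
      · exact_mod_cast (by omega : 1 ≤ N + n)
      · linarith
  refine hf.eqOn_of_preconnected_of_eventuallyEq hg hUc.isPreconnected hwU ?_ hsU
  have : {z : ℂ | 1 < z.re} ∈ nhds w :=
    (isOpen_lt continuous_const Complex.continuous_re).mem_nhds (by
      simp only [Set.mem_ofPred_eq, hw, Complex.add_re, Complex.one_re]; linarith)
  filter_upwards [this] with z hz
  rw [(hasSum_zetaRem hz N hN).tsum_eq]
  ring

theorem tsum_shift_rpow_le (N : ℕ) {p : ℝ} (hp : p < -1) :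
    ∑' n : ℕ, ((N + n : ℕ) : ℝ) ^ p ≤ ∑' n : ℕ, (n : ℝ) ^ p := by
  have h := (Real.summable_nat_rpow.2 hp).sum_add_tsum_nat_add N
  have h0 : 0 ≤ ∑ n ∈ Finset.range N, (n : ℝ) ^ p := Finset.sum_nonneg fun n _ => by positivity
  have e : ∑' n : ℕ, ((N + n : ℕ) : ℝ) ^ p = ∑' n : ℕ, ((n + N : ℕ) : ℝ) ^ p :=
    tsum_congr fun n => by rw [add_comm]
  rw [e]; linarith

theorem norm_riemannZeta_le_natCast {η : ℝ} (hη : 0 < η) (hη' : η ≤ 1 / 4) {s : ℂ}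
    (hs : 1 - η ≤ s.re) (hs' : s.re ≤ 3) (ht : 1 ≤ |s.im|) {N : ℕ} (hN : |s.im| ≤ N) :
    ‖riemannZeta s‖ ≤ (5 * ∑' n : ℕ, (n : ℝ) ^ (-1 - η) + 1) * (N : ℝ) ^ (2 * η) := by
  set Z := ∑' n : ℕ, (n : ℝ) ^ (-1 - η) with hZ
  have hN1 : (1 : ℝ) ≤ N := ht.trans hN
  have hN0 : 0 < N := by exact_mod_cast zero_lt_one.trans_le hN1
  obtain ⟨c, hc⟩ : ∃ c : ℝ, 1 / 2 < c * s.im := by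
    rcases abs_cases s.im with ⟨h, _⟩ | ⟨h, _⟩
    · exact ⟨1, by linarith⟩
    · exact ⟨-1, by linarith⟩
  have hs1 : s ≠ 1 := by rintro rfl; norm_num at ht
  have hp : -1 - η < -1 := by linarith
  have hsummable := Real.summable_nat_rpow.2 hp
  rw [riemannZeta_eq_sum_add_tsum_zetaRem (by linarith) hc N hN0]
  have b1 : ‖∑ n ∈ Finset.range N, ((n + 1 : ℕ) : ℂ) ^ (-s)‖ ≤ Z * (N : ℝ) ^ (2 * η) := by
    calc _ ≤ ∑ n ∈ Finset.range N, ((1 + n : ℕ) : ℝ) ^ (-1 - η) * (N : ℝ) ^ (2 * η) := by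
          refine norm_sum_le_of_le _ fun n hn => ?_
          rw [Complex.norm_natCast_cpow_of_pos (by omega), add_comm n 1]
          have h1 : (1 : ℝ) ≤ ((1 + n : ℕ) : ℝ) := by exact_mod_cast (by omega : 1 ≤ 1 + n)
          calc ((1 + n : ℕ) : ℝ) ^ (-s).re ≤ ((1 + n : ℕ) : ℝ) ^ ((-1 - η) + 2 * η) :=
                Real.rpow_le_rpow_of_exponent_le h1 (by simp only [Complex.neg_re]; linarith)
            _ = ((1 + n : ℕ) : ℝ) ^ (-1 - η) * ((1 + n : ℕ) : ℝ) ^ (2 * η) :=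
                Real.rpow_add (by linarith) _ _
            _ ≤ _ := by
                gcongr
                have := Finset.mem_range.1 hn
                omega
      _ ≤ _ := by
          rw [← Finset.sum_mul]
          gcongr
          exact ((summable_add_rpow 1 hp).sum_le_tsum _ fun n _ => by positivity).trans
            (tsum_shift_rpow_le 1 hp)
  have b2 : ‖(N : ℂ) ^ (1 - s) / (s - 1)‖ ≤ (N : ℝ) ^ (2 * η) := by
    rw [norm_div, Complex.norm_natCast_cpow_of_pos hN0]
    have h1 : 1 ≤ ‖s - 1‖ := by
      refine ht.trans ?_
      have := Complex.abs_im_le_norm (s - 1)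
      simpa using this
    refine (div_le_self (by positivity) h1).trans ?_
    exact Real.rpow_le_rpow_of_exponent_le hN1 (by simp; linarith)
  have b3 : ‖∑' n : ℕ, zetaRem ((N + n : ℕ) : ℝ) s‖ ≤ 4 * Z * (N : ℝ) ^ (2 * η) := by
    have hsN : ‖s‖ ≤ 4 * N := by
      refine (Complex.norm_le_abs_re_add_abs_im s).trans ?_
      rw [abs_of_nonneg (by linarith)]
      linarith
    have hb : ∀ n : ℕ, ‖zetaRem ((N + n : ℕ) : ℝ) s‖ ≤
        4 * (N : ℝ) ^ (2 * η) * ((N + n : ℕ) : ℝ) ^ (-1 - η) := by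
      intro n
      have hNn : (N : ℝ) ≤ ((N + n : ℕ) : ℝ) := by exact_mod_cast Nat.le_add_right N n
      have hNn0 : 0 < ((N + n : ℕ) : ℝ) := by linarith
      refine (norm_zetaRem_le hNn0 (by linarith) hs1).trans ?_
      calc ‖s‖ * ((N + n : ℕ) : ℝ) ^ (-s.re - 1)
          ≤ (4 * N) * ((N + n : ℕ) : ℝ) ^ ((-1 + 2 * η) + (-1 - η)) := by
            gcongr
            · linarith
            · linarith
        _ = (4 * N) * (((N + n : ℕ) : ℝ) ^ (-1 + 2 * η) * ((N + n : ℕ) : ℝ) ^ (-1 - η)) := by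
            rw [Real.rpow_add hNn0]
        _ ≤ (4 * N) * ((N : ℝ) ^ (-1 + 2 * η) * ((N + n : ℕ) : ℝ) ^ (-1 - η)) := by
            gcongr ?_ * (?_ * _)
            exact Real.rpow_le_rpow_of_nonpos (by linarith) hNn (by linarith)
        _ = _ := by
            rw [Real.rpow_add (by linarith), Real.rpow_neg_one]
            field_simp
    have hsum := (summable_add_rpow N hp).mul_left (4 * (N : ℝ) ^ (2 * η))
    calc _ ≤ ∑' n : ℕ, 4 * (N : ℝ) ^ (2 * η) * ((N + n : ℕ) : ℝ) ^ (-1 - η) :=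
          tsum_of_norm_bounded hsum.hasSum hb
      _ = 4 * (N : ℝ) ^ (2 * η) * ∑' n : ℕ, ((N + n : ℕ) : ℝ) ^ (-1 - η) := tsum_mul_left
      _ ≤ 4 * (N : ℝ) ^ (2 * η) * Z := by
          gcongr; exact tsum_shift_rpow_le N hp
      _ = _ := by ring
  refine (norm_add₃_le).trans ?_
  linarith

theorem exists_norm_riemannZeta_le {η : ℝ} (hη : 0 < η) (hη' : η ≤ 1 / 4) :
    ∃ C, 0 ≤ C ∧ ∀ s : ℂ, 1 - η ≤ s.re → s.re ≤ 3 → 1 ≤ |s.im| →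
      ‖riemannZeta s‖ ≤ C * |s.im| ^ (2 * η) := by
  refine ⟨(5 * ∑' n : ℕ, (n : ℝ) ^ (-1 - η) + 1) * 2 ^ (2 * η), ?_, fun s hs hs' ht => ?_⟩
  · have : 0 ≤ ∑' n : ℕ, (n : ℝ) ^ (-1 - η) := tsum_nonneg fun n => by positivity
    positivity
  · refine (norm_riemannZeta_le_natCast hη hη' hs hs' ht (Nat.le_ceil _)).trans ?_
    rw [mul_assoc, ← Real.mul_rpow (by norm_num) (abs_nonneg _)]
    have : 0 ≤ ∑' n : ℕ, (n : ℝ) ^ (-1 - η) := tsum_nonneg fun n => by positivity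
    gcongr
    have := Nat.ceil_lt_add_one (abs_nonneg s.im)
    linarith

/-- Subpolynomial growth in the strip `1 < Re s ≤ 2`, `|Im s| ≥ 2`. -/
def Subpolynomial (f : ℂ → ℂ) : Prop :=
  ∀ ε : ℝ, 0 < ε → ∃ C, 0 ≤ C ∧ ∀ s : ℂ, 1 < s.re → s.re ≤ 2 → 2 ≤ |s.im| →
    ‖f s‖ ≤ C * |s.im| ^ ε

theorem Subpolynomial.add {f g : ℂ → ℂ} (hf : Subpolynomial f) (hg : Subpolynomial g) :
    Subpolynomial fun s => f s + g s := by
  intro ε hε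
  obtain ⟨C, hC, h⟩ := hf ε hε
  obtain ⟨D, hD, k⟩ := hg ε hε
  refine ⟨C + D, by positivity, fun s h1 h2 h3 => ?_⟩
  rw [add_mul]
  exact norm_add_le_of_le (h s h1 h2 h3) (k s h1 h2 h3)

theorem Subpolynomial.mul {f g : ℂ → ℂ} (hf : Subpolynomial f) (hg : Subpolynomial g) :
    Subpolynomial fun s => f s * g s := by
  intro ε hε
  obtain ⟨C, hC, h⟩ := hf (ε / 2) (by positivity)
  obtain ⟨D, hD, k⟩ := hg (ε / 2) (by positivity)
  refine ⟨C * D, by positivity, fun s h1 h2 h3 => ?_⟩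
  have e : |s.im| ^ ε = |s.im| ^ (ε / 2) * |s.im| ^ (ε / 2) := by
    rw [← Real.rpow_add (by linarith)]; ring_nf
  rw [norm_mul, e, mul_mul_mul_comm]
  gcongr
  · exact h s h1 h2 h3
  · exact k s h1 h2 h3

theorem Subpolynomial.const (c : ℂ) : Subpolynomial fun _ => c := by
  intro ε hε
  refine ⟨‖c‖, norm_nonneg _, fun s _ _ h3 => ?_⟩
  exact le_mul_of_one_le_right (norm_nonneg _) (Real.one_le_rpow (by linarith) hε.le)

theorem Subpolynomial.sum {ι : Type*} (t : Finset ι) {f : ι → ℂ → ℂ}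
    (hf : ∀ i ∈ t, Subpolynomial (f i)) : Subpolynomial fun s => ∑ i ∈ t, f i s := by
  classical
  induction t using Finset.induction_on with
  | empty => simpa using Subpolynomial.const 0
  | insert a t ha ih =>
    simp_rw [Finset.sum_insert ha]
    exact (hf a (Finset.mem_insert_self _ _)).add
      (ih fun i hi => hf i (Finset.mem_insert_of_mem hi))

theorem Subpolynomial.congr {f g : ℂ → ℂ} (hf : Subpolynomial f)
    (h : ∀ s : ℂ, 1 < s.re → g s = f s) : Subpolynomial g := by
  intro ε hε
  obtain ⟨C, hC, hb⟩ := hf ε hε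
  exact ⟨C, hC, fun s h1 h2 h3 => by rw [h s h1]; exact hb s h1 h2 h3⟩

theorem subpolynomial_iteratedDeriv_riemannZeta (k : ℕ) :
    Subpolynomial (iteratedDeriv k riemannZeta) := by
  intro ε hε
  set η := min (ε / 2) (1 / 4) with hηdef
  have hη : 0 < η := by positivity
  have hη4 : η ≤ 1 / 4 := min_le_right _ _
  have hηε : 2 * η ≤ ε := by linarith [min_le_left (ε / 2) (1 / 4)]
  obtain ⟨C, hC, hb⟩ := exists_norm_riemannZeta_le hη hη4
  refine ⟨k.factorial * (C * 2 ^ ε) / η ^ k, by positivity, fun s h1 h2 h3 => ?_⟩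
  have hball : ∀ z ∈ Metric.closedBall s η, 1 - η ≤ z.re ∧ z.re ≤ 3 ∧ 1 ≤ |z.im| ∧
      |z.im| ≤ 2 * |s.im| := by
    intro z hz
    have hz' : ‖z - s‖ ≤ η := by simpa [dist_eq_norm] using hz
    have hre := (Complex.abs_re_le_norm (z - s)).trans hz'
    have him := (Complex.abs_im_le_norm (z - s)).trans hz'
    rw [Complex.sub_re, abs_le] at hre
    rw [Complex.sub_im] at him
    have i1 := abs_sub_abs_le_abs_sub z.im s.im
    have i2 := abs_sub_abs_le_abs_sub s.im z.im
    rw [abs_sub_comm] at i2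
    refine ⟨by linarith, by linarith, by linarith, by linarith⟩
  have hdiff : DiffContOnCl ℂ riemannZeta (Metric.ball s η) := by
    refine DifferentiableOn.diffContOnCl fun z hz => ?_
    rw [closure_ball _ hη.ne'] at hz
    refine (differentiableAt_riemannZeta ?_).differentiableWithinAt
    rintro rfl
    have := (hball 1 hz).2.2.1
    norm_num at this
  refine (Complex.norm_iteratedDeriv_le_of_forall_mem_sphere_norm_le
    (C := C * 2 ^ ε * |s.im| ^ ε) k hη hdiff fun z hz => ?_).trans (le_of_eq (by ring))
  obtain ⟨a1, a2, a3, a4⟩ := hball z (Metric.sphere_subset_closedBall hz)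
  refine (hb z a1 a2 a3).trans ?_
  rw [mul_assoc, ← Real.mul_rpow (by norm_num) (abs_nonneg _)]
  gcongr
  exact (Real.rpow_le_rpow_of_exponent_le a3 hηε).trans
    (Real.rpow_le_rpow (abs_nonneg _) a4 hε.le)

/-- The entire function `(s - 1) ζ(s)`, with value `1` at `s = 1`. -/
noncomputable def zetaOne : ℂ → ℂ := Function.update (fun s => (s - 1) * riemannZeta s) 1 1

theorem zetaOne_one : zetaOne 1 = 1 := Function.update_self ..

theorem zetaOne_of_ne {s : ℂ} (hs : s ≠ 1) : zetaOne s = (s - 1) * riemannZeta s :=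
  Function.update_of_ne hs ..

theorem differentiable_zetaOne : Differentiable ℂ zetaOne := by
  rw [← differentiableOn_univ,
    ← Complex.differentiableOn_compl_singleton_and_continuousAt_iff (c := 1) Filter.univ_mem]
  refine ⟨DifferentiableOn.congr (f := fun s ↦ (s - 1) * riemannZeta s) (fun s hs ↦ ?_)
    fun _ hs ↦ Function.update_of_ne (Set.mem_sdiff_singleton.mp hs).2 .., ?_⟩
  · exact ((differentiableAt_id.sub_const 1).mul
      (differentiableAt_riemannZeta (Set.mem_sdiff_singleton.mp hs).2)).differentiableWithinAt
  · exact continuousAt_update_same.2 riemannZeta_residue_one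

theorem zetaOne_ne_zero {s : ℂ} (hs : 1 ≤ s.re) : zetaOne s ≠ 0 := by
  rcases eq_or_ne s 1 with rfl | h
  · simp [zetaOne_one]
  · rw [zetaOne_of_ne h]
    exact mul_ne_zero (sub_ne_zero.2 h) (riemannZeta_ne_zero_of_one_le_re hs)

theorem exists_norm_riemannZeta_one_add_le :
    ∃ D, 0 < D ∧ ∀ x : ℝ, 0 < x → x ≤ 1 → ‖riemannZeta (1 + x)‖ ≤ D / x := by
  have hc : Continuous fun x : ℝ => zetaOne (1 + x) :=
    differentiable_zetaOne.continuous.comp (by fun_prop)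
  obtain ⟨D, hD⟩ :=
    isCompact_Icc.exists_bound_of_continuousOn (s := Set.Icc (0 : ℝ) 1) hc.continuousOn
  refine ⟨max D 1, by positivity, fun x hx hx1 => ?_⟩
  rw [le_div_iff₀ hx]
  have h := hD x ⟨hx.le, hx1⟩
  rw [zetaOne_of_ne (by simpa using hx.ne'), norm_mul] at h
  have e : ‖(1 : ℂ) + x - 1‖ = x := by simp [abs_of_pos hx]
  rw [e, mul_comm] at h
  exact h.trans (le_max_left _ _)

theorem one_le_norm_riemannZeta_prod {x : ℝ} (hx : 0 < x) (t : ℝ) :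
    1 ≤ ‖riemannZeta (1 + x)‖ ^ 3 * ‖riemannZeta (1 + x + Complex.I * t)‖ ^ 4 *
      ‖riemannZeta (1 + x + 2 * Complex.I * t)‖ := by
  have h := DirichletCharacter.norm_LFunction_product_ge_one (1 : DirichletCharacter ℂ 1) hx t
  rw [DirichletCharacter.LFunctionTrivChar] at h
  simpa only [DirichletCharacter.LFunction_modOne_eq, norm_mul, norm_pow, ge_iff_le] using h

theorem subpolynomial_inv_riemannZeta : Subpolynomial fun s => (riemannZeta s)⁻¹ := by
  intro ε hε
  set η := ε / 5 with hη
  have hη0 : 0 < η := by positivity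
  obtain ⟨D, hD, hzD⟩ := exists_norm_riemannZeta_one_add_le
  obtain ⟨C₁, hC₁, hz⟩ := subpolynomial_iteratedDeriv_riemannZeta 0 η hη0
  obtain ⟨C₂, hC₂, hz'⟩ := subpolynomial_iteratedDeriv_riemannZeta 1 η hη0
  simp only [iteratedDeriv_zero] at hz
  simp only [iteratedDeriv_one] at hz'
  set K := D ^ 3 * (C₁ * 2 ^ η) + 1 with hK
  have hK0 : 1 ≤ K := by
    have : 0 ≤ D ^ 3 * (C₁ * 2 ^ η) := by positivity
    linarith
  set a := 1 / (16 * K * (C₂ + 1) ^ 4) with ha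
  have ha0 : 0 < a := by positivity
  have ha1 : a ≤ 1 := by
    rw [ha, div_le_one (by positivity)]
    have : (1 : ℝ) ≤ (C₂ + 1) ^ 4 := one_le_pow₀ (by linarith)
    nlinarith
  set c := 2 * (C₂ + 1) * a with hc
  have hc0 : 0 < c := by positivity
  have hc4 : K * c ^ 4 = a ^ 3 := by
    have : 16 * K * (C₂ + 1) ^ 4 * a = 1 := by rw [ha]; field_simp
    calc K * c ^ 4 = (16 * K * (C₂ + 1) ^ 4 * a) * a ^ 3 := by rw [hc]; ring
      _ = a ^ 3 := by rw [this, one_mul]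
  clear_value c a K
  have lower : ∀ x : ℝ, 0 < x → x ≤ 1 → ∀ t : ℝ, 2 ≤ |t| → a * |t| ^ (-6 * η) ≤ x →
      c * |t| ^ (-5 * η) ≤ ‖riemannZeta (1 + x + Complex.I * t)‖ := by
    intro x hx hx1 t ht hxt
    have hT : 0 < |t| := by linarith
    have h := one_le_norm_riemannZeta_prod hx t
    have h2 : ‖riemannZeta (1 + x + 2 * Complex.I * t)‖ ≤ C₁ * 2 ^ η * |t| ^ η := by
      have := hz (1 + x + 2 * Complex.I * t) (by simp [hx]) (by simp; linarith)
        (by simp [abs_mul]; linarith)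
      refine this.trans (le_of_eq ?_)
      rw [mul_assoc C₁, ← Real.mul_rpow (by norm_num) (abs_nonneg _)]
      simp [abs_mul]
    have h3 : x ^ 3 ≤ K * |t| ^ η * ‖riemannZeta (1 + x + Complex.I * t)‖ ^ 4 := by
      calc x ^ 3 = x ^ 3 * 1 := by ring
        _ ≤ x ^ 3 * ((D / x) ^ 3 * ‖riemannZeta (1 + x + Complex.I * t)‖ ^ 4 *
              (C₁ * 2 ^ η * |t| ^ η)) := by
            gcongr
            refine h.trans ?_
            gcongr
            exact hzD x hx hx1
        _ = (D ^ 3 * (C₁ * 2 ^ η)) * |t| ^ η * ‖riemannZeta (1 + x + Complex.I * t)‖ ^ 4 := by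
            field_simp
        _ ≤ _ := by
            gcongr
            linarith
    by_contra! hlt
    have h4 : K * |t| ^ η * ‖riemannZeta (1 + x + Complex.I * t)‖ ^ 4 <
        K * |t| ^ η * (c * |t| ^ (-5 * η)) ^ 4 := by
      gcongr
    have h5 : K * |t| ^ η * (c * |t| ^ (-5 * η)) ^ 4 = (a * |t| ^ (-6 * η)) ^ 3 * |t| ^ (-η) := by
      have e₁ : (|t| ^ (-5 * η)) ^ 4 = |t| ^ (-20 * η) := by
        rw [← Real.rpow_mul_natCast hT.le]; push_cast; ring_nf
      have e₂ : (|t| ^ (-6 * η)) ^ 3 = |t| ^ (-18 * η) := by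
        rw [← Real.rpow_mul_natCast hT.le]; push_cast; ring_nf
      have e₃ : |t| ^ η * |t| ^ (-20 * η) = |t| ^ (-18 * η) * |t| ^ (-η) := by
        rw [← Real.rpow_add hT, ← Real.rpow_add hT]; ring_nf
      rw [mul_pow, mul_pow, e₁, e₂]
      linear_combination K * c ^ 4 * e₃ + |t| ^ (-18 * η) * |t| ^ (-η) * hc4
    have h6 : (a * |t| ^ (-6 * η)) ^ 3 * |t| ^ (-η) ≤ x ^ 3 * 1 := by
      gcongr
      exact Real.rpow_le_one_of_one_le_of_nonpos (by linarith) (by linarith)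
    linarith
  refine ⟨2 / c, by positivity, fun s h1 h2 h3 => ?_⟩
  have hT : 0 < |s.im| := by linarith
  have hs : s = 1 + ((s.re - 1 : ℝ) : ℂ) + Complex.I * s.im := by
    apply Complex.ext <;> simp
  have main : c / 2 * |s.im| ^ (-5 * η) ≤ ‖riemannZeta s‖ := by
    by_cases hx : a * |s.im| ^ (-6 * η) ≤ s.re - 1
    · have := lower (s.re - 1) (by linarith) (by linarith) s.im h3 hx
      rw [← hs] at this
      refine le_trans ?_ this
      gcongr
      linarith
    · push Not at hx
      set x := a * |s.im| ^ (-6 * η) with hxdef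
      have hx1 : x ≤ 1 := by
        refine mul_le_one₀ ha1 (by positivity) ?_
        exact Real.rpow_le_one_of_one_le_of_nonpos (by linarith) (by linarith)
      have hx0 : 0 < x := by positivity
      set w : ℂ := 1 + (x : ℂ) + Complex.I * s.im with hw
      have hlow := lower x hx0 hx1 s.im h3 le_rfl
      rw [← hw] at hlow
      have hwre : w.re = 1 + x := by simp [hw]
      have hwim : w.im = s.im := by simp [hw]
      have hseg : ∀ z ∈ segment ℝ s w, 1 < z.re ∧ z.re ≤ 2 ∧ z.im = s.im := by
        rintro z ⟨p, q, hp, hq, hpq, rfl⟩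
        have hp' : p = 1 - q := by linarith
        subst hp'
        simp only [Complex.add_re, Complex.smul_re, smul_eq_mul, Complex.add_im, Complex.smul_im,
          hwre, hwim]
        refine ⟨?_, ?_, by ring⟩
        · nlinarith
        · nlinarith
      have hmv := Convex.norm_image_sub_le_of_norm_deriv_le (𝕜 := ℂ) (f := riemannZeta)
        (s := segment ℝ s w) (x := s) (y := w) (C := C₂ * |s.im| ^ η) ?_ ?_ (convex_segment _ _)
        (left_mem_segment _ _ _) (right_mem_segment _ _ _)
      · have hd : ‖w - s‖ ≤ x := by
          have : w - s = ((1 + x - s.re : ℝ) : ℂ) := by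
            apply Complex.ext <;> simp [hwre, hwim]
          rw [this, Complex.norm_real, Real.norm_eq_abs, abs_of_nonneg (by linarith)]
          linarith
        have h7 : C₂ * |s.im| ^ η * ‖w - s‖ ≤ c / 2 * |s.im| ^ (-5 * η) := by
          calc _ ≤ C₂ * |s.im| ^ η * x := by gcongr
            _ = C₂ * a * (|s.im| ^ η * |s.im| ^ (-6 * η)) := by rw [hxdef]; ring
            _ = C₂ * a * |s.im| ^ (-5 * η) := by
                rw [← Real.rpow_add hT]; ring_nf
            _ ≤ _ := by
                gcongr
                rw [hc]; linarith
        have h8 := norm_sub_norm_le (riemannZeta w) (riemannZeta s)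
        linarith
      · intro z hz
        refine differentiableAt_riemannZeta ?_
        rintro rfl
        have := (hseg 1 hz).1
        simp at this
      · intro z hz
        obtain ⟨z1, z2, z3⟩ := hseg z hz
        have := hz' z z1 z2 (by rw [z3]; exact h3)
        rwa [z3] at this
  rw [norm_inv]
  have e : 2 / c * |s.im| ^ ε = (c / 2 * |s.im| ^ (-5 * η))⁻¹ := by
    rw [mul_inv, ← Real.rpow_neg hT.le, inv_div]
    congr 2
    rw [hη]; ring
  rw [e]
  gcongr

theorem isOpen_one_lt_re : IsOpen {s : ℂ | 1 < s.re} :=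
  isOpen_lt continuous_const Complex.continuous_re

theorem analyticOnNhd_riemannZeta : AnalyticOnNhd ℂ riemannZeta {s : ℂ | 1 < s.re} := by
  refine DifferentiableOn.analyticOnNhd (fun s hs => ?_) isOpen_one_lt_re
  refine (differentiableAt_riemannZeta ?_).differentiableWithinAt
  rintro rfl
  simp at hs

theorem analyticOnNhd_neg_deriv_div_riemannZeta :
    AnalyticOnNhd ℂ (fun s => -deriv riemannZeta s / riemannZeta s) {s : ℂ | 1 < s.re} :=
  (analyticOnNhd_riemannZeta.deriv.neg).div analyticOnNhd_riemannZeta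
    fun _ hs => riemannZeta_ne_zero_of_one_le_re (le_of_lt hs)

theorem subpolynomial_iteratedDeriv_neg_deriv_div_riemannZeta (k : ℕ) :
    Subpolynomial (iteratedDeriv k fun s => -deriv riemannZeta s / riemannZeta s) := by
  induction k using Nat.strong_induction_on with
  | _ k ih =>
    set G : ℂ → ℂ := fun s => -deriv riemannZeta s / riemannZeta s with hG
    have hmul : Set.EqOn (fun s => riemannZeta s * G s) (fun s => -deriv riemannZeta s)
        {s : ℂ | 1 < s.re} := by
      intro s hs
      exact mul_div_cancel₀ _ (riemannZeta_ne_zero_of_one_le_re (le_of_lt hs))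
    have hder := hmul.iteratedDeriv_of_isOpen isOpen_one_lt_re k
    have key : ∀ s : ℂ, 1 < s.re → iteratedDeriv k G s = (riemannZeta s)⁻¹ *
        ((-1) * iteratedDeriv (k + 1) riemannZeta s + (-1) * ∑ i ∈ Finset.range k,
          ((k.choose (i + 1) : ℂ) * iteratedDeriv (i + 1) riemannZeta s) *
            iteratedDeriv (k - (i + 1)) G s) := by
      intro s hs
      have h := hder hs
      rw [iteratedDeriv_fun_mul (analyticOnNhd_riemannZeta s hs).contDiffAt
        (analyticOnNhd_neg_deriv_div_riemannZeta s hs).contDiffAt,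
        iteratedDeriv_fun_neg, ← iteratedDeriv_succ', Finset.sum_range_succ'] at h
      simp only [Nat.choose_zero_right, Nat.cast_one, one_mul, iteratedDeriv_zero, Nat.sub_zero]
        at h
      rw [eq_inv_mul_iff_mul_eq₀ (riemannZeta_ne_zero_of_one_le_re hs.le)]
      linear_combination h
    refine Subpolynomial.congr (Subpolynomial.mul subpolynomial_inv_riemannZeta
      (Subpolynomial.add ((Subpolynomial.const _).mul (subpolynomial_iteratedDeriv_riemannZeta _))
        ((Subpolynomial.const _).mul (Subpolynomial.sum _ fun i hi =>
          ((Subpolynomial.const _).mul (subpolynomial_iteratedDeriv_riemannZeta _)).mul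
            (ih (k - (i + 1)) ?_))))) key
    have := Finset.mem_range.1 hi
    omega

/-- The coefficients `Λ(n) - 1` of the Dirichlet series of `-deriv ζ / ζ - ζ`. -/
noncomputable def vonMangoldtSubOne : ℕ → ℂ :=
  (fun n => (ArithmeticFunction.vonMangoldt n : ℂ)) - 1

theorem LSeriesSummable_vonMangoldtSubOne {s : ℂ} (hs : 1 < s.re) :
    LSeriesSummable vonMangoldtSubOne s :=
  (ArithmeticFunction.LSeriesSummable_vonMangoldt hs).sub (LSeriesSummable_one_iff.2 hs)

theorem abscissaOfAbsConv_vonMangoldtSubOne_le :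
    LSeries.abscissaOfAbsConv vonMangoldtSubOne ≤ (1 : ℝ) :=
  LSeries.abscissaOfAbsConv_le_of_forall_lt_LSeriesSummable
    fun _ hy => LSeriesSummable_vonMangoldtSubOne (by simpa using hy)

theorem abscissaOfAbsConv_vonMangoldtSubOne_lt {s : ℂ} (hs : 1 < s.re) :
    LSeries.abscissaOfAbsConv vonMangoldtSubOne < s.re :=
  abscissaOfAbsConv_vonMangoldtSubOne_le.trans_lt (by exact_mod_cast hs)

theorem LSeriesSummable_iterate_logMul_vonMangoldtSubOne (k : ℕ) {s : ℂ} (hs : 1 < s.re) :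
    LSeriesSummable (LSeries.logMul^[k] vonMangoldtSubOne) s :=
  LSeriesSummable_of_abscissaOfAbsConv_lt_re (by
    rw [LSeries.absicssaOfAbsConv_logPowMul]
    exact abscissaOfAbsConv_vonMangoldtSubOne_lt hs)

theorem LSeries_vonMangoldtSubOne {s : ℂ} (hs : 1 < s.re) :
    LSeries vonMangoldtSubOne s = -deriv riemannZeta s / riemannZeta s - riemannZeta s := by
  rw [vonMangoldtSubOne, LSeries_sub (ArithmeticFunction.LSeriesSummable_vonMangoldt hs)
    (LSeriesSummable_one_iff.2 hs), LSeries_one_eq_riemannZeta hs,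
    ArithmeticFunction.LSeries_vonMangoldt_eq_deriv_riemannZeta_div hs]

theorem neg_deriv_div_riemannZeta_sub_eq {s : ℂ} (hs : 1 < s.re) :
    -deriv riemannZeta s / riemannZeta s - riemannZeta s =
      -(deriv zetaOne s / zetaOne s) - dslope zetaOne 1 s := by
  have hs1 : s ≠ 1 := by rintro rfl; simp at hs
  have hs1' : s - 1 ≠ 0 := sub_ne_zero.2 hs1
  have hz := riemannZeta_ne_zero_of_one_le_re hs.le
  have hd : deriv zetaOne s = riemannZeta s + (s - 1) * deriv riemannZeta s := by
    have : zetaOne =ᶠ[nhds s] fun s => (s - 1) * riemannZeta s := by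
      filter_upwards [isOpen_ne.mem_nhds hs1] with z hz using zetaOne_of_ne hz
    rw [this.deriv_eq]
    have h := ((hasDerivAt_id s).sub_const 1).fun_mul (differentiableAt_riemannZeta hs1).hasDerivAt
    simpa using h.deriv
  rw [dslope_of_ne _ hs1, slope_def_field, hd, zetaOne_of_ne hs1, zetaOne_one]
  field_simp
  ring

theorem exists_norm_iteratedDeriv_le_of_abs_im_le (k : ℕ) :
    ∃ C, 0 ≤ C ∧ ∀ s : ℂ, 1 < s.re → s.re ≤ 2 → |s.im| ≤ 2 →
      ‖iteratedDeriv k (LSeries vonMangoldtSubOne) s‖ ≤ C := by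
  set E : ℂ → ℂ := fun s => -(deriv zetaOne s / zetaOne s) - dslope zetaOne 1 s with hE
  have hone : AnalyticOnNhd ℂ zetaOne {s : ℂ | 1 ≤ s.re} :=
    fun s _ => differentiable_zetaOne.analyticAt s
  have hds : Differentiable ℂ (dslope zetaOne 1) := by
    rw [← differentiableOn_univ, Complex.differentiableOn_dslope univ_mem]
    exact differentiable_zetaOne.differentiableOn
  have hEan : AnalyticOnNhd ℂ E {s : ℂ | 1 ≤ s.re} :=
    ((hone.deriv.div hone fun s hs => zetaOne_ne_zero hs).neg).sub fun s _ => hds.analyticAt s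
  have hcont : ContinuousOn (iteratedDeriv k E) (Set.Icc 1 2 ×ℂ Set.Icc (-2) 2) := by
    rw [iteratedDeriv_eq_iterate]
    refine (hEan.iterated_deriv k).continuousOn.mono fun s hs => ?_
    exact (Complex.mem_reProdIm.1 hs).1.1
  obtain ⟨C, hC⟩ := (isCompact_Icc.reProdIm isCompact_Icc).exists_bound_of_continuousOn hcont
  refine ⟨max C 0, le_max_right _ _, fun s h1 h2 h3 => ?_⟩
  have heq : Set.EqOn (LSeries vonMangoldtSubOne) E {s : ℂ | 1 < s.re} := fun s hs => by
    rw [LSeries_vonMangoldtSubOne hs, neg_deriv_div_riemannZeta_sub_eq hs]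
  rw [heq.iteratedDeriv_of_isOpen isOpen_one_lt_re k h1]
  exact (hC s (Complex.mem_reProdIm.2 ⟨⟨h1.le, h2⟩, abs_le.1 h3⟩)).trans (le_max_left _ _)

theorem exists_norm_LSeries_iterate_logMul_le (k : ℕ) :
    ∃ C, 0 ≤ C ∧ ∀ s : ℂ, 1 < s.re → s.re ≤ 2 →
      ‖LSeries (LSeries.logMul^[k] vonMangoldtSubOne) s‖ ≤ C * (1 + |s.im|) ^ (1 / 2 : ℝ) := by
  obtain ⟨C₁, hC₁, h₁⟩ := exists_norm_iteratedDeriv_le_of_abs_im_le k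
  obtain ⟨C₂, hC₂, h₂⟩ :=
    subpolynomial_iteratedDeriv_neg_deriv_div_riemannZeta k (1 / 2) (by norm_num)
  obtain ⟨C₃, hC₃, h₃⟩ := subpolynomial_iteratedDeriv_riemannZeta k (1 / 2) (by norm_num)
  refine ⟨C₁ + (C₂ + C₃), by positivity, fun s h1 h2 => ?_⟩
  have e : ‖LSeries (LSeries.logMul^[k] vonMangoldtSubOne) s‖ =
      ‖iteratedDeriv k (LSeries vonMangoldtSubOne) s‖ := by
    rw [LSeries_iteratedDeriv k (abscissaOfAbsConv_vonMangoldtSubOne_lt h1), norm_mul, norm_pow]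
    simp
  rw [e, add_mul]
  rcases le_total |s.im| 2 with h | h
  · have h4 : C₁ ≤ C₁ * (1 + |s.im|) ^ (1 / 2 : ℝ) :=
      le_mul_of_one_le_right hC₁ (Real.one_le_rpow (by linarith [abs_nonneg s.im]) (by norm_num))
    have h5 : 0 ≤ (C₂ + C₃) * (1 + |s.im|) ^ (1 / 2 : ℝ) := by positivity
    linarith [h₁ s h1 h2 h]
  · have heq : Set.EqOn (LSeries vonMangoldtSubOne)
        (fun s => -deriv riemannZeta s / riemannZeta s - riemannZeta s) {s : ℂ | 1 < s.re} :=
      fun s hs => LSeries_vonMangoldtSubOne hs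
    rw [heq.iteratedDeriv_of_isOpen isOpen_one_lt_re k h1,
      iteratedDeriv_fun_sub (analyticOnNhd_neg_deriv_div_riemannZeta s h1).contDiffAt
      (analyticOnNhd_riemannZeta s h1).contDiffAt]
    have h5 : 0 ≤ C₁ * (1 + |s.im|) ^ (1 / 2 : ℝ) := by positivity
    have h6 : (C₂ + C₃) * |s.im| ^ (1 / 2 : ℝ) ≤ (C₂ + C₃) * (1 + |s.im|) ^ (1 / 2 : ℝ) := by
      gcongr; linarith
    have h7 := norm_sub_le_of_le (h₂ s h1 h2 h) (h₃ s h1 h2 h)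
    linarith

/-- The kernel `max (1 - t) 0` on `t > 0`, as a difference of power functions on `(0, 1]`. -/
noncomputable def tentKernel (t : ℝ) : ℂ :=
  Set.indicator (Set.Ioc 0 1) (fun _ => 1) t -
    Set.indicator (Set.Ioc 0 1) (fun t : ℝ => (t : ℂ) ^ (1 : ℂ)) t

theorem tentKernel_eq {t : ℝ} (ht : 0 < t) : tentKernel t = ((max (1 - t) 0 : ℝ) : ℂ) := by
  rcases le_or_gt t 1 with h | h
  · have hm : t ∈ Set.Ioc (0 : ℝ) 1 := ⟨ht, h⟩
    rw [tentKernel, Set.indicator_of_mem hm, Set.indicator_of_mem hm, max_eq_left (by linarith)]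
    simp
  · have hm : t ∉ Set.Ioc (0 : ℝ) 1 := fun hm => h.not_ge hm.2
    rw [tentKernel, Set.indicator_of_notMem hm, Set.indicator_of_notMem hm,
      max_eq_right (by linarith)]
    simp

theorem continuousAt_tentKernel {t : ℝ} (ht : 0 < t) : ContinuousAt tentKernel t := by
  have h : ContinuousAt (fun t : ℝ => ((max (1 - t) 0 : ℝ) : ℂ)) t := by fun_prop
  refine h.congr ?_
  filter_upwards [lt_mem_nhds ht] with u hu using (tentKernel_eq hu).symm

theorem hasMellin_tentKernel {s : ℂ} (hs : 0 < s.re) :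
    HasMellin tentKernel s (1 / (s * (s + 1))) := by
  have h1 := hasMellin_one_Ioc hs
  have h2 := hasMellin_cpow_Ioc 1 (s := s) (by simp; linarith)
  have h := hasMellin_sub h1.1 h2.1
  have h0 : s ≠ 0 := by rintro rfl; simp at hs
  have h0' : s + 1 ≠ 0 := by
    intro h
    have := congrArg Complex.re h
    simp at this
    linarith
  have e : 1 / s - 1 / (s + 1) = 1 / (s * (s + 1)) := by
    field_simp
    ring
  rw [h1.2, h2.2, e] at h
  exact h

theorem norm_one_div_mul_add_one_le {σ : ℝ} (hσ : 1 ≤ σ) (y : ℝ) :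
    ‖1 / (((σ : ℂ) + y * Complex.I) * (σ + y * Complex.I + 1))‖ ≤ (1 + y ^ 2)⁻¹ := by
  have h1 : 1 + y ^ 2 ≤ ‖(σ : ℂ) + y * Complex.I‖ ^ 2 := by
    rw [Complex.sq_norm, Complex.normSq_add_mul_I]
    nlinarith
  have h2 : ‖(σ : ℂ) + y * Complex.I‖ ≤ ‖(σ : ℂ) + y * Complex.I + 1‖ := by
    rw [← sq_le_sq₀ (norm_nonneg _) (norm_nonneg _), add_right_comm, Complex.sq_norm,
      Complex.sq_norm, Complex.normSq_add_mul_I]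
    have : (σ : ℂ) + 1 = ((σ + 1 : ℝ) : ℂ) := by push_cast; rfl
    rw [this, Complex.normSq_add_mul_I]
    nlinarith
  rw [norm_div, norm_one, one_div, norm_mul]
  refine inv_anti₀ (by positivity) (h1.trans ?_)
  rw [sq]
  gcongr

theorem mul_tentKernel_eq (f : ℕ → ℂ) {x σ : ℝ} (hx : 0 < x) (hσ : 1 ≤ σ) {n : ℕ} (hn : n ≠ 0) :
    f n * tentKernel (n / x) = (1 / (2 * Real.pi) : ℝ) *
      ∫ y : ℝ, LSeries.term f (σ + y * Complex.I) n * ((x : ℂ) ^ ((σ : ℂ) + y * Complex.I) *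
        (1 / (((σ : ℂ) + y * Complex.I) * (σ + y * Complex.I + 1)))) := by
  have hn' : (0 : ℝ) < n := by positivity
  have hm : ∀ y : ℝ, mellin tentKernel (σ + y * Complex.I) =
      1 / (((σ : ℂ) + y * Complex.I) * (σ + y * Complex.I + 1)) := fun y =>
    (hasMellin_tentKernel (by simp; linarith)).2
  have hv : Complex.VerticalIntegrable (mellin tentKernel) σ := by
    have hInt := integrable_inv_one_add_sq
    refine hInt.mono' ?_ (.of_forall fun y => ?_)
    · simp_rw [hm]
      refine Measurable.aestronglyMeasurable ?_
      fun_prop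
    · rw [hm]
      exact norm_one_div_mul_add_one_le hσ y
  have key := mellinInv_mellin_eq σ tentKernel (x := n / x) (by positivity)
    (hasMellin_tentKernel (by simp; linarith)).1 hv (continuousAt_tentKernel (by positivity))
  rw [← key, mellinInv, Complex.real_smul, mul_left_comm, ← MeasureTheory.integral_const_mul]
  congr 2
  ext y
  rw [hm, smul_eq_mul, LSeries.term_of_ne_zero hn, Complex.ofReal_div,
    Complex.cpow_neg, ← mul_assoc, ← mul_assoc, div_eq_mul_inv (f n)]
  congr 1
  rw [mul_assoc]
  congr 1
  have h := Complex.mul_cpow_ofReal_nonneg (a := n / x) (b := x) (by positivity) hx.le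
    (σ + y * Complex.I)
  rw [← Complex.ofReal_mul, div_mul_cancel₀ _ hx.ne', Complex.ofReal_div] at h
  have hx0 : (x : ℂ) ^ ((σ : ℂ) + y * Complex.I) ≠ 0 := by
    rw [Complex.cpow_ne_zero_iff]
    exact Or.inl (by exact_mod_cast hx.ne')
  have hnx : ((n : ℝ) / (x : ℂ)) ^ ((σ : ℂ) + y * Complex.I) ≠ 0 := by
    rw [Complex.cpow_ne_zero_iff]
    exact Or.inl (by exact_mod_cast (by positivity : (n / x : ℝ) ≠ 0))
  rw [Complex.ofReal_natCast] at *
  rw [h]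
  field_simp

theorem hasSum_mul_tentKernel {f : ℕ → ℂ} {x σ : ℝ} (hx : 0 < x) (hσ : 1 < σ)
    (hf : ∀ s : ℂ, 1 < s.re → LSeriesSummable f s) :
    HasSum (fun n : ℕ => if n = 0 then 0 else f n * tentKernel (n / x))
      ((1 / (2 * Real.pi) : ℝ) *
        ∫ y : ℝ, LSeries f (σ + y * Complex.I) * ((x : ℂ) ^ ((σ : ℂ) + y * Complex.I) *
          (1 / (((σ : ℂ) + y * Complex.I) * (σ + y * Complex.I + 1))))) := by
  set F : ℕ → ℝ → ℂ := fun n y => LSeries.term f (σ + y * Complex.I) n *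
    ((x : ℂ) ^ ((σ : ℂ) + y * Complex.I) *
      (1 / (((σ : ℂ) + y * Complex.I) * (σ + y * Complex.I + 1)))) with hF
  have hle : ∀ n y, ‖F n y‖ ≤ ‖LSeries.term f σ n‖ * x ^ σ * (1 + y ^ 2)⁻¹ := by
    intro n y
    rw [hF, norm_mul, norm_mul, Complex.norm_cpow_eq_rpow_re_of_pos hx, ← mul_assoc]
    have h1 : ‖LSeries.term f (σ + y * Complex.I) n‖ ≤ ‖LSeries.term f σ n‖ :=
      LSeries.norm_term_le_of_re_le_re f (by simp) n
    have h2 := norm_one_div_mul_add_one_le hσ.le y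
    have h3 : ((σ : ℂ) + y * Complex.I).re = σ := by simp
    rw [h3]
    gcongr
  have hInt : ∀ n, MeasureTheory.Integrable (F n) := by
    intro n
    refine (integrable_inv_one_add_sq.const_mul (‖LSeries.term f σ n‖ * x ^ σ)).mono' ?_
      (.of_forall (hle n))
    refine Measurable.aestronglyMeasurable ?_
    rcases eq_or_ne n 0 with rfl | hn
    · simp [hF]
    · simp only [hF, LSeries.term_of_ne_zero hn]
      fun_prop
  have hsum : Summable fun n => ∫ y, ‖F n y‖ := by
    refine Summable.of_nonneg_of_le (fun n => MeasureTheory.integral_nonneg fun _ => norm_nonneg _)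
      (fun n => ?_)
      (((hf σ (by simpa using hσ)).norm.mul_right (x ^ σ)).mul_right
        (∫ y : ℝ, (1 + y ^ 2)⁻¹))
    rw [← MeasureTheory.integral_const_mul]
    exact MeasureTheory.integral_mono (hInt n).norm (integrable_inv_one_add_sq.const_mul _) (hle n)
  have h := (MeasureTheory.hasSum_integral_of_summable_integral_norm hInt hsum).mul_left
    ((1 / (2 * Real.pi) : ℝ) : ℂ)
  have e₁ : (fun n : ℕ => if n = 0 then 0 else f n * tentKernel (n / x)) =
      fun n => ((1 / (2 * Real.pi) : ℝ) : ℂ) * ∫ y, F n y := by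
    ext n
    split_ifs with hn
    · simp [hn, hF]
    · exact mul_tentKernel_eq f hx hσ.le hn
  have e₂ : (fun y : ℝ => ∑' n, F n y) = fun y : ℝ => LSeries f (σ + y * Complex.I) *
      ((x : ℂ) ^ ((σ : ℂ) + y * Complex.I) *
        (1 / (((σ : ℂ) + y * Complex.I) * (σ + y * Complex.I + 1)))) := by
    ext y
    simp only [hF]
    rw [tsum_mul_right, LSeries]
  rwa [← e₁, e₂] at h

theorem exists_norm_sum_mul_one_sub_div_le {f : ℕ → ℂ}
    (hf : ∀ s : ℂ, 1 < s.re → LSeriesSummable f s) {C : ℝ} (hC : 0 ≤ C)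
    (hle : ∀ s : ℂ, 1 < s.re → s.re ≤ 2 → ‖LSeries f s‖ ≤ C * (1 + |s.im|) ^ (1 / 2 : ℝ)) :
    ∃ D, 0 ≤ D ∧ ∀ x : ℝ, 3 ≤ x →
      ‖∑ n ∈ Finset.Ioc 0 ⌊x⌋₊, f n * (1 - n / x)‖ ≤ D * x := by
  set J : ℝ := ∫ y : ℝ, (1 + ‖y‖ ^ 2) ^ (-(3 / 2 : ℝ) / 2) with hJ
  have hInt : MeasureTheory.Integrable fun y : ℝ => (1 + ‖y‖ ^ 2) ^ (-(3 / 2 : ℝ) / 2) :=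
    integrable_rpow_neg_one_add_norm_sq (by norm_num)
  have hJ0 : 0 ≤ J := MeasureTheory.integral_nonneg fun _ => by positivity
  refine ⟨1 / (2 * Real.pi) * (C * 2 * Real.exp 1 * J), by positivity, fun x hx => ?_⟩
  have hx0 : 0 < x := by linarith
  have hlog : 1 ≤ Real.log x := by
    rw [Real.le_log_iff_exp_le hx0]
    linarith [Real.exp_one_lt_d9]
  set σ : ℝ := 1 + 1 / Real.log x with hσ
  have hσ1 : 1 < σ := by rw [hσ]; linarith [show 0 < 1 / Real.log x by positivity]
  have hσ2 : σ ≤ 2 := by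
    have : 1 / Real.log x ≤ 1 := by rw [div_le_one (by linarith)]; exact hlog
    linarith
  have hxσ : x ^ σ = x * Real.exp 1 := by
    rw [hσ, Real.rpow_add hx0, Real.rpow_one, Real.rpow_def_of_pos hx0,
      mul_one_div_cancel (by linarith)]
  have h := hasSum_mul_tentKernel hx0 hσ1 hf
  have h2 : HasSum (fun n : ℕ => if n = 0 then 0 else f n * tentKernel (n / x))
      (∑ n ∈ Finset.Ioc 0 ⌊x⌋₊, f n * (1 - n / x)) := by
    have h3 := hasSum_sum_of_ne_finset_zero (L := .unconditional ℕ)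
      (f := fun n : ℕ => if n = 0 then 0 else f n * tentKernel (n / x))
      (s := Finset.Ioc 0 ⌊x⌋₊) (fun n hn => ?_)
    · convert h3 using 1
      refine Finset.sum_congr rfl fun n hn => ?_
      obtain ⟨hn0, hn1⟩ := Finset.mem_Ioc.1 hn
      have hnx : (n : ℝ) ≤ x := (Nat.le_floor_iff hx0.le).1 hn1
      have : (n : ℝ) / x ≤ 1 := by rw [div_le_one hx0]; exact hnx
      rw [if_neg hn0.ne', tentKernel_eq (by positivity), max_eq_left (by linarith)]
      push_cast
      rfl
    · split_ifs with h0
      · rfl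
      have hnx : x < n := by
        by_contra! h'
        exact hn (Finset.mem_Ioc.2 ⟨Nat.pos_of_ne_zero h0, Nat.le_floor h'⟩)
      have : 1 < (n : ℝ) / x := by rw [one_lt_div hx0]; exact hnx
      rw [tentKernel_eq (by positivity), max_eq_right (by linarith)]
      simp
  rw [h2.unique h, norm_mul, Complex.norm_real, Real.norm_of_nonneg (by positivity), mul_assoc]
  refine mul_le_mul_of_nonneg_left ?_ (by positivity)
  have e : C * 2 * Real.exp 1 * J * x = ∫ y : ℝ, C * 2 * (x * Real.exp 1) *
      (1 + ‖y‖ ^ 2) ^ (-(3 / 2 : ℝ) / 2) := by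
    rw [MeasureTheory.integral_const_mul]
    ring
  rw [e]
  refine MeasureTheory.norm_integral_le_of_norm_le (hInt.const_mul _) (.of_forall fun y => ?_)
  have hre : ((σ : ℂ) + y * Complex.I).re = σ := by simp
  have him : ((σ : ℂ) + y * Complex.I).im = y := by simp
  rw [norm_mul, norm_mul, Complex.norm_cpow_eq_rpow_re_of_pos hx0, hre, hxσ]
  have h4 := hle (σ + y * Complex.I) (by rw [hre]; exact hσ1) (by rw [hre]; exact hσ2)
  rw [him] at h4
  have h5 := norm_one_div_mul_add_one_le hσ1.le y
  have hpos : 0 < 1 + y ^ 2 := by positivity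
  have h6 : (1 + |y|) ^ (1 / 2 : ℝ) ≤ 2 * (1 + y ^ 2) ^ (1 / 4 : ℝ) := by
    have : (1 + |y|) ≤ (4 * (1 + y ^ 2)) ^ (1 / 2 : ℝ) := by
      rw [← Real.sqrt_eq_rpow]
      apply Real.le_sqrt_of_sq_le
      nlinarith [sq_abs y, sq_nonneg (|y| - 1)]
    calc (1 + |y|) ^ (1 / 2 : ℝ) ≤ ((4 * (1 + y ^ 2)) ^ (1 / 2 : ℝ)) ^ (1 / 2 : ℝ) := by
          gcongr
      _ = 4 ^ (1 / 4 : ℝ) * (1 + y ^ 2) ^ (1 / 4 : ℝ) := by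
          rw [← Real.rpow_mul (by positivity), Real.mul_rpow (by norm_num) hpos.le]
          norm_num
      _ ≤ 2 * (1 + y ^ 2) ^ (1 / 4 : ℝ) := by
          gcongr
          calc (4 : ℝ) ^ (1 / 4 : ℝ) ≤ 4 ^ (1 / 2 : ℝ) := by
                apply Real.rpow_le_rpow_of_exponent_le <;> norm_num
            _ = 2 := by
                rw [show (4 : ℝ) = 2 ^ (2 : ℝ) by norm_num, ← Real.rpow_mul (by norm_num)]
                norm_num
  have h7 : (1 + y ^ 2) ^ (1 / 4 : ℝ) * (1 + y ^ 2)⁻¹ = (1 + ‖y‖ ^ 2) ^ (-(3 / 2 : ℝ) / 2) := by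
    rw [← Real.rpow_neg_one, ← Real.rpow_add hpos, Real.norm_eq_abs, sq_abs]
    norm_num
  calc ‖LSeries f (σ + y * Complex.I)‖ * (x * Real.exp 1 *
        ‖1 / (((σ : ℂ) + y * Complex.I) * (σ + y * Complex.I + 1))‖)
      ≤ (C * (2 * (1 + y ^ 2) ^ (1 / 4 : ℝ))) * (x * Real.exp 1 * (1 + y ^ 2)⁻¹) := by
        gcongr
        exact h4.trans (by gcongr)
    _ = C * 2 * (x * Real.exp 1) * ((1 + y ^ 2) ^ (1 / 4 : ℝ) * (1 + y ^ 2)⁻¹) := by ring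
    _ = _ := by rw [h7]

theorem iterate_logMul_vonMangoldtSubOne (k n : ℕ) :
    LSeries.logMul^[k] vonMangoldtSubOne n =
      (((ArithmeticFunction.vonMangoldt n - 1) * Real.log n ^ k : ℝ) : ℂ) := by
  induction k with
  | zero => simp [vonMangoldtSubOne]
  | succ k ih =>
    rw [Function.iterate_succ_apply', LSeries.logMul, ih, ← Complex.natCast_log]
    push_cast
    ring

theorem exists_abs_sum_vonMangoldt_sub_one_mul_le (k : ℕ) :
    ∃ D, 0 ≤ D ∧ ∀ x : ℝ, 3 ≤ x → |∑ n ∈ Finset.Ioc 0 ⌊x⌋₊,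
      (ArithmeticFunction.vonMangoldt n - 1) * Real.log n ^ k * (x - n)| ≤ D * x ^ 2 := by
  obtain ⟨C, hC, h⟩ := exists_norm_LSeries_iterate_logMul_le k
  obtain ⟨D, hD, h'⟩ := exists_norm_sum_mul_one_sub_div_le
    (fun s hs => LSeriesSummable_iterate_logMul_vonMangoldtSubOne k hs) hC h
  refine ⟨D, hD, fun x hx => ?_⟩
  have hx0 : 0 < x := by linarith
  have h1 := h' x hx
  have e : ∑ n ∈ Finset.Ioc 0 ⌊x⌋₊, LSeries.logMul^[k] vonMangoldtSubOne n * (1 - n / x) =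
      ((∑ n ∈ Finset.Ioc 0 ⌊x⌋₊,
        (ArithmeticFunction.vonMangoldt n - 1) * Real.log n ^ k * (x - n)) / x : ℝ) := by
    rw [Finset.sum_div, Complex.ofReal_sum]
    refine Finset.sum_congr rfl fun n _ => ?_
    rw [iterate_logMul_vonMangoldtSubOne]
    have : (x : ℂ) ≠ 0 := by exact_mod_cast hx0.ne'
    push_cast
    field_simp
  rw [e, Complex.norm_real, Real.norm_eq_abs, abs_div, abs_of_pos hx0, div_le_iff₀ hx0] at h1
  linarith [h1]

theorem abs_sum_le_of_abs_sum_mul_sub_le {a : ℕ → ℝ} {D L x h : ℝ} (hL : 0 ≤ L)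
    (hx : 6 ≤ x) (h1 : 1 ≤ h) (h2 : h ≤ x / 2)
    (hT : ∀ y : ℝ, 3 ≤ y → |∑ n ∈ Finset.Ioc 0 ⌊y⌋₊, a n * (y - n)| ≤ D * y ^ 2)
    (ha : ∀ n : ℕ, 0 < n → (n : ℝ) ≤ 2 * x → -L ≤ a n) :
    |∑ n ∈ Finset.Ioc 0 ⌊x⌋₊, a n| ≤ 5 * D * x ^ 2 / h + 2 * h * L := by
  have hD : 0 ≤ D := by
    have := (abs_nonneg _).trans (hT 3 le_rfl)
    linarith
  have hcard : ∀ y : ℝ, 0 ≤ y → (((Finset.Ioc ⌊y⌋₊ ⌊y + h⌋₊).card : ℕ) : ℝ) ≤ 2 * h := by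
    intro y hy
    rw [Nat.card_Ioc, Nat.cast_sub (Nat.floor_mono (by linarith))]
    linarith [Nat.floor_le (show 0 ≤ y + h by linarith), Nat.lt_floor_add_one y]
  have hadd : ∀ y : ℝ, 0 ≤ y → ∀ f : ℕ → ℝ, ∑ n ∈ Finset.Ioc 0 ⌊y + h⌋₊, f n =
      ∑ n ∈ Finset.Ioc 0 ⌊y⌋₊, f n + ∑ n ∈ Finset.Ioc ⌊y⌋₊ ⌊y + h⌋₊, f n := fun y _ f =>
    (Finset.sum_Ioc_consecutive f (Nat.zero_le _) (Nat.floor_mono (by linarith))).symm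
  have hlow : ∀ y : ℝ, 0 ≤ y → y + h ≤ 2 * x → ∀ w : ℕ → ℝ,
      (∀ n ∈ Finset.Ioc ⌊y⌋₊ ⌊y + h⌋₊, 0 ≤ w n ∧ w n ≤ h) →
      -(2 * h * (h * L)) ≤ ∑ n ∈ Finset.Ioc ⌊y⌋₊ ⌊y + h⌋₊, a n * w n := by
    intro y hy hy2 w hw
    have h3 : ∑ _n ∈ Finset.Ioc ⌊y⌋₊ ⌊y + h⌋₊, -(h * L) ≤
        ∑ n ∈ Finset.Ioc ⌊y⌋₊ ⌊y + h⌋₊, a n * w n := by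
      refine Finset.sum_le_sum fun n hn => ?_
      obtain ⟨hw0, hw1⟩ := hw n hn
      obtain ⟨hn0, hn1⟩ := Finset.mem_Ioc.1 hn
      have h4 := ha n (by omega) (((Nat.le_floor_iff (by linarith)).1 hn1).trans hy2)
      nlinarith [mul_le_mul_of_nonneg_right h4 hw0, mul_le_mul_of_nonneg_left hw1 hL]
    rw [Finset.sum_const, nsmul_eq_mul] at h3
    nlinarith [mul_le_mul_of_nonneg_right (hcard y hy) (show 0 ≤ h * L by positivity)]
  have hmem : ∀ y : ℝ, 0 ≤ y → ∀ n ∈ Finset.Ioc ⌊y⌋₊ ⌊y + h⌋₊, y < n ∧ (n : ℝ) ≤ y + h := by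
    intro y hy n hn
    obtain ⟨hn0, hn1⟩ := Finset.mem_Ioc.1 hn
    exact ⟨(Nat.floor_lt hy).1 hn0, (Nat.le_floor_iff (by linarith)).1 hn1⟩
  have hup : h * ∑ n ∈ Finset.Ioc 0 ⌊x⌋₊, a n ≤ 5 * D * x ^ 2 + 2 * h * (h * L) := by
    have e := hadd x (by linarith) fun n => a n * (x + h - n)
    have e2 : ∑ n ∈ Finset.Ioc 0 ⌊x⌋₊, a n * (x + h - n) =
        ∑ n ∈ Finset.Ioc 0 ⌊x⌋₊, a n * (x - n) + h * ∑ n ∈ Finset.Ioc 0 ⌊x⌋₊, a n := by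
      rw [Finset.mul_sum, ← Finset.sum_add_distrib]
      exact Finset.sum_congr rfl fun n _ => by ring
    have h3 := hlow x (by linarith) (by linarith) (fun n => x + h - n) fun n hn => by
      have := hmem x (by linarith) n hn
      constructor <;> linarith
    have h4 := (abs_le.1 (hT (x + h) (by linarith))).2
    have h5 := (abs_le.1 (hT x (by linarith))).1
    have h6 : (x + h) ^ 2 ≤ 4 * x ^ 2 := by nlinarith
    nlinarith [mul_le_mul_of_nonneg_left h6 hD]
  have hdown : -(5 * D * x ^ 2 + 2 * h * (h * L)) ≤ h * ∑ n ∈ Finset.Ioc 0 ⌊x⌋₊, a n := by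
    have hxh : x - h + h = x := by ring
    have e := hadd (x - h) (by linarith) fun n => a n * (x - n)
    have e3 := hadd (x - h) (by linarith) a
    have e2 : ∑ n ∈ Finset.Ioc 0 ⌊x - h⌋₊, a n * (x - n) =
        ∑ n ∈ Finset.Ioc 0 ⌊x - h⌋₊, a n * (x - h - n) +
          h * ∑ n ∈ Finset.Ioc 0 ⌊x - h⌋₊, a n := by
      rw [Finset.mul_sum, ← Finset.sum_add_distrib]
      exact Finset.sum_congr rfl fun n _ => by ring
    have e4 : h * ∑ n ∈ Finset.Ioc ⌊x - h⌋₊ ⌊x - h + h⌋₊, a n =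
        ∑ n ∈ Finset.Ioc ⌊x - h⌋₊ ⌊x - h + h⌋₊, a n * (x - n) +
        ∑ n ∈ Finset.Ioc ⌊x - h⌋₊ ⌊x - h + h⌋₊, a n * (n - (x - h)) := by
      rw [Finset.mul_sum, ← Finset.sum_add_distrib]
      exact Finset.sum_congr rfl fun n _ => by ring
    have h3 := hlow (x - h) (by linarith) (by linarith) (fun n => n - (x - h)) fun n hn => by
      have := hmem (x - h) (by linarith) n hn
      constructor <;> linarith
    rw [hxh] at e e3 e4 h3
    have h4 := (abs_le.1 (hT x (by linarith))).1
    have h5 := (abs_le.1 (hT (x - h) (by linarith))).2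
    have h6 : (x - h) ^ 2 ≤ 4 * x ^ 2 := by nlinarith
    have h7 := mul_le_mul_of_nonneg_left h6 hD
    rw [e3, mul_add]
    nlinarith
  have hpos : 0 < h := by linarith
  have e : 5 * D * x ^ 2 / h + 2 * h * L = (5 * D * x ^ 2 + 2 * h * (h * L)) / h := by
    field_simp
  rw [e, le_div_iff₀ hpos, ← abs_of_pos hpos, ← abs_mul, abs_of_pos hpos, abs_le]
  constructor <;> linarith

theorem isBigO_sum_vonMangoldt_sub_one_mul_log_pow (m : ℕ) :
    (fun x : ℝ => ∑ n ∈ Finset.Ioc 0 ⌊x⌋₊,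
      (ArithmeticFunction.vonMangoldt n - 1) * Real.log n ^ (2 * m)) =O[atTop]
        fun x => x * Real.log x ^ m := by
  obtain ⟨D, hD, hT⟩ := exists_abs_sum_vonMangoldt_sub_one_mul_le (2 * m)
  have hlog : ∀ᶠ x : ℝ in atTop, ‖Real.log x ^ m‖ ≤ 1 / 2 * ‖id x‖ :=
    (Real.isLittleO_pow_log_id_atTop (n := m)).def (by norm_num)
  refine Asymptotics.IsBigO.of_bound (10 * D + 4 ^ m) ?_
  filter_upwards [hlog, eventually_ge_atTop 6] with x h1 hx
  have hx0 : 0 < x := by linarith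
  have hl1 : 1 ≤ Real.log x := by
    rw [Real.le_log_iff_exp_le hx0]
    linarith [Real.exp_one_lt_d9]
  set l := Real.log x with hl
  have hlm : 1 ≤ l ^ m := one_le_pow₀ hl1
  rw [Real.norm_of_nonneg (by positivity), id, Real.norm_of_nonneg hx0.le] at h1
  have hL : ∀ n : ℕ, 0 < n → (n : ℝ) ≤ 2 * x → Real.log n ^ (2 * m) ≤ (2 * l) ^ (2 * m) := by
    intro n hn hn2
    have h3 : 0 ≤ Real.log n := Real.log_natCast_nonneg n
    refine pow_le_pow_left₀ h3 ?_ _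
    calc Real.log n ≤ Real.log (2 * x) := Real.log_le_log (by positivity) hn2
      _ ≤ Real.log (x * x) := Real.log_le_log (by positivity) (by nlinarith)
      _ = 2 * l := by rw [Real.log_mul hx0.ne' hx0.ne', hl]; ring
  have key := abs_sum_le_of_abs_sum_mul_sub_le (L := (2 * l) ^ (2 * m)) (x := x)
    (h := x / (2 * l ^ m)) (by positivity) hx
    (by rw [one_le_div (by positivity)]; linarith)
    (div_le_div_of_nonneg_left hx0.le (by norm_num) (by linarith)) hT (fun n hn hn2 => by
      have h3 := hL n hn hn2
      have h4 : 0 ≤ Real.log n ^ (2 * m) := by positivity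
      have h5 : 0 ≤ ArithmeticFunction.vonMangoldt n := ArithmeticFunction.vonMangoldt_nonneg
      nlinarith [mul_nonneg h5 h4])
  rw [Real.norm_eq_abs, Real.norm_of_nonneg (by positivity)]
  refine key.trans (le_of_eq ?_)
  have : (2 * l) ^ (2 * m) = 4 ^ m * l ^ m * l ^ m := by
    rw [pow_mul, mul_pow, mul_pow]
    ring
  rw [this]
  field_simp
  ring

theorem sum_vonMangoldt_mul_log_pow_sub_nonneg_le (k : ℕ) {x : ℝ} (hx : 1 ≤ x) :
    |∑ n ∈ Finset.Ioc 0 ⌊x⌋₊, ArithmeticFunction.vonMangoldt n * Real.log n ^ k -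
      ∑ p ∈ Finset.Ioc 0 ⌊x⌋₊ with p.Prime, Real.log p * Real.log p ^ k| ≤
      (Chebyshev.psi x - Chebyshev.theta x) * Real.log x ^ k := by
  have hd : ∀ n : ℕ, 0 ≤ ArithmeticFunction.vonMangoldt n -
      (if n.Prime then Real.log n else 0) := by
    intro n
    split_ifs with h
    · rw [ArithmeticFunction.vonMangoldt_apply_prime h, sub_self]
    · simp
  have e : ∑ n ∈ Finset.Ioc 0 ⌊x⌋₊, ArithmeticFunction.vonMangoldt n * Real.log n ^ k -
      ∑ p ∈ Finset.Ioc 0 ⌊x⌋₊ with p.Prime, Real.log p * Real.log p ^ k =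
      ∑ n ∈ Finset.Ioc 0 ⌊x⌋₊, (ArithmeticFunction.vonMangoldt n -
        (if n.Prime then Real.log n else 0)) * Real.log n ^ k := by
    rw [Finset.sum_filter, ← Finset.sum_sub_distrib]
    refine Finset.sum_congr rfl fun n _ => ?_
    split_ifs <;> ring
  have e2 : Chebyshev.psi x - Chebyshev.theta x =
      ∑ n ∈ Finset.Ioc 0 ⌊x⌋₊, (ArithmeticFunction.vonMangoldt n -
        (if n.Prime then Real.log n else 0)) := by
    rw [Chebyshev.psi, Chebyshev.theta, Finset.sum_filter, ← Finset.sum_sub_distrib]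
  rw [e, e2, Finset.sum_mul, abs_of_nonneg]
  · refine Finset.sum_le_sum fun n hn => mul_le_mul_of_nonneg_left ?_ (hd n)
    obtain ⟨hn0, hn1⟩ := Finset.mem_Ioc.1 hn
    exact pow_le_pow_left₀ (Real.log_natCast_nonneg n) (Real.log_le_log (by exact_mod_cast hn0)
      ((Nat.le_floor_iff (by linarith)).1 hn1)) _
  · exact Finset.sum_nonneg fun n _ => mul_nonneg (hd n) (pow_nonneg (Real.log_natCast_nonneg n) _)

theorem isBigO_log_pow_mul_sqrt (n : ℕ) :
    (fun x : ℝ => 2 * √x * Real.log x ^ n) =O[atTop] fun x => x := by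
  have h := (isLittleO_log_rpow_rpow_atTop (n : ℝ) (show (0 : ℝ) < 1 / 2 by norm_num)).isBigO
  have h2 := ((Asymptotics.isBigO_refl (fun x : ℝ => √x) atTop).const_mul_left 2).mul h
  refine h2.congr' (.of_forall fun x => by simp [Real.rpow_natCast]) ?_
  filter_upwards [eventually_ge_atTop 0] with x hx
  rw [← Real.sqrt_eq_rpow, Real.mul_self_sqrt hx]

theorem isBigO_id_mul_log_pow (m : ℕ) :
    (fun x : ℝ => x) =O[atTop] fun x => x * Real.log x ^ m := by
  refine Asymptotics.IsBigO.of_bound 1 ?_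
  filter_upwards [eventually_ge_atTop (Real.exp 1)] with x hx
  have hx0 : 0 < x := (Real.exp_pos 1).trans_le hx
  have hl : 1 ≤ Real.log x := (Real.le_log_iff_exp_le hx0).2 hx
  rw [norm_mul, one_mul]
  refine le_mul_of_one_le_right (norm_nonneg _) ?_
  rw [norm_pow]
  exact one_le_pow₀ (hl.trans (le_abs_self _))

theorem abs_sum_Ioc_sub_integral_le {f : ℝ → ℝ} (hf : MonotoneOn f (Set.Ici 1))
    (hf0 : ∀ x, 1 ≤ x → 0 ≤ f x) {x : ℝ} (hx : 1 ≤ x) :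
    |∑ n ∈ Finset.Ioc 0 ⌊x⌋₊, f n - ∫ t in (1 : ℝ)..x, f t| ≤ f x := by
  have hN1 : 1 ≤ ⌊x⌋₊ := (Nat.le_floor_iff (by linarith)).2 (by simpa using hx)
  have hN1' : (1 : ℝ) ≤ ⌊x⌋₊ := by exact_mod_cast hN1
  have hNx : (⌊x⌋₊ : ℝ) ≤ x := Nat.floor_le (by linarith)
  have hxN := Nat.lt_floor_add_one x
  set N := ⌊x⌋₊ with hN
  have hmono : MonotoneOn f (Set.Icc ((1 : ℕ) : ℝ) N) :=
    hf.mono fun t ht => by simpa using ht.1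
  have hInt : ∀ a b : ℝ, 1 ≤ a → 1 ≤ b → IntervalIntegrable f MeasureTheory.volume a b :=
    fun a b ha hb => (hf.mono fun t ht => (le_min ha hb).trans ht.1).intervalIntegrable
  have h1 := MonotoneOn.sum_le_integral_Ico hN1 hmono
  have h2 := MonotoneOn.integral_le_sum_Ico hN1 hmono
  rw [Nat.cast_one] at h1 h2
  have e1 : ∑ n ∈ Finset.Ioc 0 N, f n = ∑ n ∈ Finset.Ico 1 N, f n + f N := by
    rw [← Finset.sum_Ico_succ_top hN1]
    exact Finset.sum_congr (by ext; simp; omega) fun _ _ => rfl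
  have e2 : ∑ n ∈ Finset.Ioc 0 N, f n = f 1 + ∑ n ∈ Finset.Ico 1 N, f ((n + 1 : ℕ) : ℝ) := by
    rw [Finset.sum_Ico_add' (fun n : ℕ => f n), ← Nat.cast_one, ← Finset.sum_eq_sum_Ico_succ_bot
      (f := fun n : ℕ => f n) (by omega)]
    exact Finset.sum_congr (by ext; simp; omega) fun _ _ => rfl
  have e3 := intervalIntegral.integral_add_adjacent_intervals (hInt 1 N le_rfl hN1')
    (hInt N x hN1' hx)
  have h3 : 0 ≤ ∫ t in (N : ℝ)..x, f t := intervalIntegral.integral_nonneg hNx fun t ht =>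
    hf0 t (hN1'.trans ht.1)
  have h4 : ∫ t in (N : ℝ)..x, f t ≤ f x := by
    have h5 : ∫ t in (N : ℝ)..x, f t ≤ ∫ _t in (N : ℝ)..x, f x :=
      intervalIntegral.integral_mono_on hNx (hInt N x hN1' hx) intervalIntegrable_const
        fun t ht => hf (hN1'.trans ht.1) hx ht.2
    rw [intervalIntegral.integral_const, smul_eq_mul] at h5
    nlinarith [hf0 x hx]
  have h6 : f N ≤ f x := hf hN1' hx hNx
  have h7 := hf0 1 le_rfl
  rw [abs_le]
  constructor <;> linarith

theorem isBigO_sum_prime_log_pow_sub_integral (m : ℕ) :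
    (fun x : ℝ => ∑ p ∈ Finset.Ioc 0 ⌊x⌋₊ with p.Prime, Real.log p ^ (2 * m + 1) -
      ∫ t in (1 : ℝ)..x, Real.log t ^ (2 * m)) =O[atTop] fun x => x * Real.log x ^ m := by
  have h1 := isBigO_sum_vonMangoldt_sub_one_mul_log_pow m
  have h2 : (fun x : ℝ =>
      ∑ n ∈ Finset.Ioc 0 ⌊x⌋₊, ArithmeticFunction.vonMangoldt n * Real.log n ^ (2 * m) -
      ∑ p ∈ Finset.Ioc 0 ⌊x⌋₊ with p.Prime, Real.log p * Real.log p ^ (2 * m)) =O[atTop]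
        fun x => x * Real.log x ^ m := by
    refine Asymptotics.IsBigO.trans (Asymptotics.IsBigO.of_bound 1 ?_)
      ((isBigO_log_pow_mul_sqrt (2 * m + 1)).trans (isBigO_id_mul_log_pow m))
    filter_upwards [eventually_ge_atTop 1] with x hx
    have hl : 0 ≤ Real.log x := Real.log_nonneg hx
    rw [one_mul, Real.norm_eq_abs, Real.norm_of_nonneg (by positivity), pow_succ', ← mul_assoc]
    exact (sum_vonMangoldt_mul_log_pow_sub_nonneg_le (2 * m) hx).trans
      (mul_le_mul_of_nonneg_right (Chebyshev.psi_sub_theta_le hx) (by positivity))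
  have h3 : (fun x : ℝ => ∑ n ∈ Finset.Ioc 0 ⌊x⌋₊, Real.log n ^ (2 * m) -
      ∫ t in (1 : ℝ)..x, Real.log t ^ (2 * m)) =O[atTop] fun x => x * Real.log x ^ m := by
    refine Asymptotics.IsBigO.trans (Asymptotics.IsBigO.of_bound 1 ?_)
      ((Real.isLittleO_pow_log_id_atTop (n := 2 * m)).isBigO.trans (isBigO_id_mul_log_pow m))
    filter_upwards [eventually_ge_atTop 1] with x hx
    have hl : 0 ≤ Real.log x := Real.log_nonneg hx
    rw [one_mul, Real.norm_eq_abs, Real.norm_of_nonneg (by positivity)]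
    refine abs_sum_Ioc_sub_integral_le (f := fun t => Real.log t ^ (2 * m))
      (fun a ha b _ hab => ?_) (fun x hx => pow_nonneg (Real.log_nonneg hx) _) hx
    exact pow_le_pow_left₀ (Real.log_nonneg ha)
      (Real.log_le_log (zero_lt_one.trans_le ha) hab) _
  refine ((h1.sub h2).add h3).congr_left fun x => ?_
  simp only [sub_mul, Finset.sum_sub_distrib, one_mul, pow_succ']
  ring

theorem hasDerivAt_cpow_div_log_pow (c : ℂ) (j : ℕ) {t : ℝ} (ht : 1 < t) :
    HasDerivAt (fun t : ℝ => (t : ℂ) ^ c / (Real.log t : ℂ) ^ j)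
      ((t : ℂ) ^ (c - 1) * (c / (Real.log t : ℂ) ^ j - j / (Real.log t : ℂ) ^ (j + 1))) t := by
  have ht0 : 0 < t := by linarith
  have hl : (Real.log t : ℂ) ≠ 0 := by exact_mod_cast (Real.log_pos ht).ne'
  have h1 : HasDerivAt (fun t : ℝ => (t : ℂ) ^ c) (c * (t : ℂ) ^ (c - 1)) t := by
    simpa using (((hasDerivAt_id (t : ℂ)).cpow_const (c := c)
      (Or.inl (by simpa using ht0))).comp_ofReal)
  have h2 := ((Real.hasDerivAt_log ht0.ne').ofReal_comp).fun_pow j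
  refine (h1.fun_div h2 (pow_ne_zero _ hl)).congr_deriv ?_
  have ht0' : (t : ℂ) ≠ 0 := by exact_mod_cast ht0.ne'
  rw [Complex.cpow_sub _ _ ht0', Complex.cpow_one]
  push_cast
  rcases j with _ | j
  · simp
    field_simp
  · simp only [Nat.add_sub_cancel]
    field_simp
    ring

theorem hasDerivAt_rpow_div_log_pow (r : ℝ) (j : ℕ) {t : ℝ} (ht : 1 < t) :
    HasDerivAt (fun t : ℝ => t ^ r / Real.log t ^ j)
      (t ^ (r - 1) * (r / Real.log t ^ j - j / Real.log t ^ (j + 1))) t := by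
  have ht0 : 0 < t := by linarith
  have hl : Real.log t ≠ 0 := (Real.log_pos ht).ne'
  have h2 := (Real.hasDerivAt_log ht0.ne').fun_pow j
  refine ((Real.hasDerivAt_rpow_const (p := r) (Or.inl ht0.ne')).fun_div h2
    (pow_ne_zero _ hl)).congr_deriv ?_
  rw [Real.rpow_sub ht0, Real.rpow_one]
  rcases j with _ | j
  · simp
    field_simp
  · simp only [Nat.add_sub_cancel]
    field_simp
    ring

theorem continuousOn_cpow_mul_div_log_pow (c a b : ℂ) (i j : ℕ) :
    ContinuousOn (fun t : ℝ => (t : ℂ) ^ c *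
      (a / (Real.log t : ℂ) ^ i - b / (Real.log t : ℂ) ^ j)) (Set.Ioi 1) := by
  intro t ht
  have ht' : (1 : ℝ) < t := ht
  have hl : (Real.log t : ℂ) ≠ 0 := by exact_mod_cast (Real.log_pos ht').ne'
  have h1 : ContinuousAt (fun t : ℝ => (Real.log t : ℂ)) t :=
    (Real.continuousAt_log (by linarith)).ofReal
  have h2 : ContinuousAt (fun t : ℝ => (t : ℂ) ^ c) t :=
    Complex.continuous_ofReal.continuousAt.cpow continuousAt_const
      (Or.inl (by simpa using zero_lt_one.trans ht'))
  exact (h2.mul ((continuousAt_const.div (h1.pow _) (pow_ne_zero _ hl)).sub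
    (continuousAt_const.div (h1.pow _) (pow_ne_zero _ hl)))).continuousWithinAt

theorem uIcc_two_subset_Ioi_one {x : ℝ} (hx : 2 ≤ x) : Set.uIcc 2 x ⊆ Set.Ioi (1 : ℝ) := by
  intro t ht
  rw [Set.uIcc_of_le hx] at ht
  exact one_lt_two.trans_le ht.1

theorem intervalIntegrable_cpow_mul_div_log_pow (c a : ℂ) (i : ℕ) {x : ℝ} (hx : 2 ≤ x) :
    IntervalIntegrable (fun t : ℝ => (t : ℂ) ^ c * (a / (Real.log t : ℂ) ^ i))
      MeasureTheory.volume 2 x := by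
  have h := (continuousOn_cpow_mul_div_log_pow c a 0 i 0).mono (uIcc_two_subset_Ioi_one hx)
  simp only [zero_div, sub_zero] at h
  exact h.intervalIntegrable

theorem isBigO_const_rpow_div_log_pow {r : ℝ} (hr : 0 < r) (j : ℕ) (c : ℂ) :
    (fun _ : ℝ => c) =O[atTop] fun x : ℝ => x ^ r / Real.log x ^ j := by
  have h := (isLittleO_log_rpow_rpow_atTop (j : ℝ) hr).isBigO
  have h2 := (h.mul (Asymptotics.isBigO_refl (fun x : ℝ => (Real.log x ^ j)⁻¹) atTop))
  refine (Asymptotics.isBigO_const_const c one_ne_zero _).trans (h2.congr' ?_ ?_)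
  · filter_upwards [eventually_gt_atTop 1] with x hx
    rw [Real.rpow_natCast, mul_inv_cancel₀ (pow_ne_zero _ (Real.log_pos hx).ne')]
  · exact .of_forall fun x => (div_eq_mul_inv _ _).symm

theorem isBigO_integral_of_isBigO_rpow_div_log_pow {f : ℝ → ℂ} {r : ℝ} (hr : -1 < r) {j : ℕ}
    (hInt : ∀ x, 2 ≤ x → IntervalIntegrable f MeasureTheory.volume 2 x)
    (hf : f =O[atTop] fun t : ℝ => t ^ r / Real.log t ^ j) :
    (fun x : ℝ => ∫ t in (2 : ℝ)..x, f t) =O[atTop] fun x : ℝ => x ^ (r + 1) / Real.log x ^ j := by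
  have hr' : 0 < r + 1 := by linarith
  obtain ⟨C, hC, hf⟩ := hf.exists_pos
  have hlog := Real.tendsto_log_atTop.eventually_ge_atTop (2 * j / (r + 1))
  obtain ⟨x₀, hx₀⟩ := ((hf.bound.and hlog).and (eventually_ge_atTop 2)).exists_forall_of_atTop
  have h2 : 2 ≤ x₀ := (hx₀ x₀ le_rfl).2
  have hsplit : (fun x : ℝ => (∫ t in (2 : ℝ)..x₀, f t) + ∫ t in x₀..x, f t) =ᶠ[atTop]
      fun x : ℝ => ∫ t in (2 : ℝ)..x, f t := by
    filter_upwards [eventually_ge_atTop x₀] with x hx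
    exact intervalIntegral.integral_add_adjacent_intervals (hInt x₀ h2)
      ((hInt x₀ h2).symm.trans (hInt x (h2.trans hx)))
  refine Asymptotics.IsBigO.congr' ((isBigO_const_rpow_div_log_pow hr' j _).add ?_) hsplit .rfl
  refine Asymptotics.IsBigO.of_bound (C * (2 / (r + 1))) ?_
  filter_upwards [eventually_ge_atTop x₀] with x hx
  set H : ℝ → ℝ := fun t => t ^ (r + 1) / Real.log t ^ j with hH
  set H' : ℝ → ℝ := fun t =>
    t ^ (r + 1 - 1) * ((r + 1) / Real.log t ^ j - j / Real.log t ^ (j + 1)) with hH'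
  have hIcc : ∀ t ∈ Set.uIcc x₀ x, 1 < t := fun t ht => by
    rw [Set.uIcc_of_le hx] at ht
    linarith [ht.1]
  have hH0 : ∀ t, x₀ ≤ t → 0 ≤ H t := fun t ht => by
    have := Real.log_pos (show 1 < t by linarith)
    have : 0 < t := by linarith
    positivity
  have hcont : ContinuousOn H' (Set.uIcc x₀ x) := by
    intro t ht
    have ht' := hIcc t ht
    have hl := (Real.log_pos ht').ne'
    have h1 := Real.continuousAt_log (show t ≠ 0 by linarith)
    exact ((Real.continuousAt_rpow_const t _ (Or.inl (by linarith))).mul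
      ((continuousAt_const.div (h1.pow _) (pow_ne_zero _ hl)).sub
      (continuousAt_const.div (h1.pow _) (pow_ne_zero _ hl)))).continuousWithinAt
  have hHint : ∫ t in x₀..x, H' t = H x - H x₀ :=
    intervalIntegral.integral_eq_sub_of_hasDerivAt
      (fun t ht => hasDerivAt_rpow_div_log_pow (r + 1) j (hIcc t ht)) hcont.intervalIntegrable
  have hbd : ∀ t ∈ Set.Ioc x₀ x, ‖f t‖ ≤ C * (2 / (r + 1)) * H' t := by
    intro t ht
    obtain ⟨⟨h3, h4⟩, h5⟩ := hx₀ t ht.1.le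
    have hl := Real.log_pos (show 1 < t by linarith)
    have ht0 : 0 < t := by linarith
    rw [Real.norm_of_nonneg (by positivity)] at h3
    refine h3.trans ?_
    rw [mul_assoc]
    refine mul_le_mul_of_nonneg_left ?_ hC.le
    rw [div_le_iff₀ hr'] at h4
    have e : 2 / (r + 1) * H' t - t ^ r / Real.log t ^ j =
        t ^ r / Real.log t ^ (j + 1) * ((Real.log t * (r + 1) - 2 * j) / (r + 1)) := by
      rw [hH', add_sub_cancel_right]
      field_simp
      ring
    have h6 : 0 ≤ 2 / (r + 1) * H' t - t ^ r / Real.log t ^ j := by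
      rw [e]
      exact mul_nonneg (by positivity) (div_nonneg (by linarith) hr'.le)
    linarith
  calc ‖∫ t in x₀..x, f t‖ ≤ ∫ t in x₀..x, C * (2 / (r + 1)) * H' t :=
        intervalIntegral.norm_integral_le_of_norm_le hx (.of_forall hbd)
          (hcont.intervalIntegrable.const_mul _)
    _ = C * (2 / (r + 1)) * (H x - H x₀) := by
        rw [intervalIntegral.integral_const_mul, hHint]
    _ ≤ C * (2 / (r + 1)) * ‖H x‖ := by
        refine mul_le_mul_of_nonneg_left ?_ (by positivity)
        rw [Real.norm_of_nonneg (hH0 x hx)]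
        linarith [hH0 x₀ le_rfl]

theorem isBigO_cpow_div_log_pow (s c : ℂ) (j : ℕ) :
    (fun t : ℝ => (t : ℂ) ^ s * (c / (Real.log t : ℂ) ^ j)) =O[atTop]
      fun t : ℝ => t ^ s.re / Real.log t ^ j := by
  refine Asymptotics.IsBigO.of_bound ‖c‖ ?_
  filter_upwards [eventually_gt_atTop 0] with t ht
  rw [norm_mul, norm_div, Complex.norm_cpow_eq_rpow_re_of_pos ht, norm_pow, Complex.norm_real,
    norm_div, norm_pow, Real.norm_of_nonneg (by positivity : 0 ≤ t ^ s.re)]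
  exact le_of_eq (by ring)

theorem isBigO_integral_cpow_div_log_sub {s : ℂ} (hs : -1 < s.re) (N : ℕ) :
    (fun x : ℝ => (∫ t in (2 : ℝ)..x, (t : ℂ) ^ s * (1 / (Real.log t : ℂ))) -
      ∑ j ∈ Finset.range N, (j.factorial : ℂ) / (s + 1) ^ (j + 1) *
        ((x : ℂ) ^ (s + 1) / (Real.log x : ℂ) ^ (j + 1))) =O[atTop]
      fun x : ℝ => x ^ (s.re + 1) / Real.log x ^ (N + 1) := by
  have hw : s + 1 ≠ 0 := fun h => by
    have := congrArg Complex.re h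
    simp at this
    linarith
  set Q : ℝ → ℂ := fun x => ∑ j ∈ Finset.range N, (j.factorial : ℂ) / (s + 1) ^ (j + 1) *
        ((x : ℂ) ^ (s + 1) / (Real.log x : ℂ) ^ (j + 1)) with hQ
  set c : ℂ := (N.factorial : ℂ) / (s + 1) ^ N with hc
  have hd : ∀ t : ℝ, 1 < t → HasDerivAt Q ((t : ℂ) ^ s * (1 / (Real.log t : ℂ) ^ 1 -
      c / (Real.log t : ℂ) ^ (N + 1))) t := by
    intro t ht
    have hl : (Real.log t : ℂ) ≠ 0 := by exact_mod_cast (Real.log_pos ht).ne'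
    refine (HasDerivAt.fun_sum fun j _ => (hasDerivAt_cpow_div_log_pow (s + 1) (j + 1)
      ht).const_mul ((j.factorial : ℂ) / (s + 1) ^ (j + 1))).congr_deriv ?_
    have h := Finset.sum_range_sub' (fun j : ℕ => (t : ℂ) ^ s *
      ((j.factorial : ℂ) / (s + 1) ^ j / (Real.log t : ℂ) ^ (j + 1))) N
    simp only [Nat.factorial_zero, Nat.cast_one, pow_zero, div_one, zero_add] at h
    rw [mul_sub, ← h]
    refine Finset.sum_congr rfl fun j _ => ?_
    rw [add_sub_cancel_right, Nat.factorial_succ]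
    push_cast
    field_simp
    ring
  have hR := isBigO_integral_of_isBigO_rpow_div_log_pow hs (j := N + 1)
    (f := fun t => (t : ℂ) ^ s * (c / (Real.log t : ℂ) ^ (N + 1))) (fun x hx =>
      intervalIntegrable_cpow_mul_div_log_pow s c (N + 1) hx) (isBigO_cpow_div_log_pow s c (N + 1))
  refine (hR.sub (isBigO_const_rpow_div_log_pow (by linarith) (N + 1) (Q 2))).congr' ?_ .rfl
  filter_upwards [eventually_ge_atTop 2] with x hx
  have hsub := uIcc_two_subset_Ioi_one hx
  have hi := fun (a : ℂ) (i : ℕ) => intervalIntegrable_cpow_mul_div_log_pow s a i hx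
  have h := intervalIntegral.integral_eq_sub_of_hasDerivAt (fun t ht => hd t (hsub ht))
    ((continuousOn_cpow_mul_div_log_pow s 1 c 1 (N + 1)).mono hsub).intervalIntegrable
  simp only [mul_sub] at h
  rw [intervalIntegral.integral_sub (hi 1 1) (hi c (N + 1))] at h
  simp only [pow_one] at h
  linear_combination -h

theorem piPow_eq_sum_ite (s : ℂ) {x : ℝ} (hx : 2 ≤ x) (k : ℕ) :
    piPow s x = (2 : ℂ) ^ s + ∑ n ∈ Finset.Ioc 2 ⌊x⌋₊, ((n : ℝ) : ℂ) ^ s /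
      (Real.log (n : ℝ) : ℂ) ^ k * (if n.Prime then (Real.log n : ℂ) ^ k else 0) := by
  have h2 : 2 ≤ ⌊x⌋₊ := (Nat.le_floor_iff (by linarith)).2 (by simpa using hx)
  have e : (⌊x⌋₊ + 1).primesBelow = insert 2 (Finset.filter Nat.Prime (Finset.Ioc 2 ⌊x⌋₊)) := by
    ext p
    simp only [Nat.mem_primesBelow, Finset.mem_insert, Finset.mem_filter, Finset.mem_Ioc]
    constructor
    · rintro ⟨h, hp⟩
      rcases hp.two_le.eq_or_lt with h' | h'
      · exact Or.inl h'.symm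
      · exact Or.inr ⟨⟨h', by omega⟩, hp⟩
    · rintro (rfl | ⟨⟨h, h'⟩, hp⟩)
      · exact ⟨by omega, Nat.prime_two⟩
      · exact ⟨by omega, hp⟩
  rw [piPow, e, Finset.sum_insert (by simp), Finset.sum_filter]
  congr 1
  refine Finset.sum_congr rfl fun n hn => ?_
  split_ifs with hp
  · have hl : (Real.log (n : ℝ) : ℂ) ≠ 0 := by
      exact_mod_cast (Real.log_pos (by exact_mod_cast hp.one_lt)).ne'
    rw [div_mul_cancel₀ _ (pow_ne_zero _ hl), Complex.ofReal_natCast]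
  · simp

theorem hasDerivAt_integral_log_pow (k : ℕ) {t : ℝ} (ht : 0 < t) :
    HasDerivAt (fun t : ℝ => ((∫ u in (1 : ℝ)..t, Real.log u ^ k : ℝ) : ℂ))
      ((Real.log t : ℂ) ^ k) t := by
  have hc : ContinuousOn (fun u : ℝ => Real.log u ^ k) (Set.Ioi 0) :=
    (Real.continuousOn_log.mono fun u hu => ne_of_gt hu).pow k
  have h := intervalIntegral.integral_hasDerivAt_right (f := fun u : ℝ => Real.log u ^ k)
    (a := 1) (b := t)
    (hc.mono fun u hu => (lt_min one_pos ht).trans_le hu.1).intervalIntegrable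
    (hc.stronglyMeasurableAtFilter isOpen_Ioi t ht)
    (hc.continuousAt (Ioi_mem_nhds ht))
  simpa using h.ofReal_comp

theorem piPow_sub_integral_isBigO {s : ℂ} (hs : -1 < s.re) (m : ℕ) :
    (fun x : ℝ => piPow s x - ∫ t in (2 : ℝ)..x, (t : ℂ) ^ s * (1 / (Real.log t : ℂ)))
      =O[atTop] fun x : ℝ => x ^ (s.re + 1) / Real.log x ^ (m + 1) := by
  set k := 2 * m + 1 with hk
  set c : ℕ → ℂ := fun n => if n.Prime then (Real.log n : ℂ) ^ k else 0 with hc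
  set g : ℝ → ℂ := fun t => (t : ℂ) ^ s / (Real.log t : ℂ) ^ k with hg
  set g' : ℝ → ℂ := fun t => (t : ℂ) ^ (s - 1) *
    (s / (Real.log t : ℂ) ^ k - k / (Real.log t : ℂ) ^ (k + 1)) with hg'
  set M : ℝ → ℂ := fun t => ((∫ u in (1 : ℝ)..t, Real.log u ^ (2 * m) : ℝ) : ℂ) with hM
  set S : ℝ → ℂ := fun t => ∑ n ∈ Finset.Icc 0 ⌊t⌋₊, c n with hS
  set E : ℝ → ℂ := fun t => S t - M t with hE
  have hEO : E =O[atTop] fun x : ℝ => x * Real.log x ^ m := by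
    refine (Complex.isBigO_ofReal_left.2 (isBigO_sum_prime_log_pow_sub_integral m)).congr_left
      fun x => ?_
    simp only [hE, hM, hS, hc]
    rw [← Finset.sum_filter, Complex.ofReal_sub, Complex.ofReal_sum]
    congr 1
    refine Finset.sum_congr ?_ fun n _ => by push_cast; rfl
    ext n
    simp only [Finset.mem_filter, Finset.mem_Ioc, Finset.mem_Icc]
    exact ⟨fun h => ⟨⟨h.1.1.le, h.1.2⟩, h.2⟩, fun h => ⟨⟨h.2.pos, h.1.2⟩, h.2⟩⟩
  have hgd : ∀ t : ℝ, 1 < t → HasDerivAt g (g' t) t := fun t ht =>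
    hasDerivAt_cpow_div_log_pow s k ht
  have hg'c : ContinuousOn g' (Set.Ioi 1) :=
    continuousOn_cpow_mul_div_log_pow (s - 1) s k k (k + 1)
  have hMd : ∀ t : ℝ, 0 < t → HasDerivAt M ((Real.log t : ℂ) ^ (2 * m)) t := fun t ht =>
    hasDerivAt_integral_log_pow _ ht
  have hgS : ∀ x, 2 ≤ x → IntervalIntegrable (fun t => g' t * S t) MeasureTheory.volume 2 x := by
    intro x hx
    rw [intervalIntegrable_iff_integrableOn_Icc_of_le hx]
    refine integrableOn_mul_sum_Icc c (by norm_num) ?_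
    exact (hg'c.mono fun t ht => one_lt_two.trans_le ht.1).integrableOn_Icc
  have hgM : ∀ x, 2 ≤ x → IntervalIntegrable (fun t => g' t * M t) MeasureTheory.volume 2 x := by
    intro x hx
    refine ((hg'c.mono (uIcc_two_subset_Ioi_one hx)).mul fun t ht =>
      (hMd t ?_).continuousAt.continuousWithinAt).intervalIntegrable
    exact zero_lt_one.trans (uIcc_two_subset_Ioi_one hx ht)
  have hg'O : g' =O[atTop] fun t : ℝ => t ^ (s.re - 1) / Real.log t ^ k := by
    have h1 := isBigO_cpow_div_log_pow (s - 1) s k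
    have h2 := isBigO_cpow_div_log_pow (s - 1) k (k + 1)
    rw [Complex.sub_re, Complex.one_re] at h1 h2
    refine (h1.sub (h2.trans ?_)).congr_left fun t => by simp only [hg', mul_sub]
    refine Asymptotics.IsBigO.of_bound 1 ?_
    filter_upwards [eventually_ge_atTop (Real.exp 1)] with t ht
    have ht0 : 0 < t := (Real.exp_pos 1).trans_le ht
    have hl : 1 ≤ Real.log t := (Real.le_log_iff_exp_le ht0).2 ht
    rw [Real.norm_of_nonneg (by positivity), Real.norm_of_nonneg (by positivity), one_mul]
    gcongr
    omega
  have hgE : (fun t => g' t * E t) =O[atTop] fun t : ℝ => t ^ s.re / Real.log t ^ (m + 1) := by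
    refine (hg'O.mul hEO).congr' .rfl ?_
    filter_upwards [eventually_gt_atTop 1] with t ht
    have hl := (Real.log_pos ht).ne'
    have ht0 : 0 < t := by linarith
    rw [Real.rpow_sub ht0, Real.rpow_one, hk, show 2 * m + 1 = m + (m + 1) by ring, pow_add]
    field_simp
  have hI := isBigO_integral_of_isBigO_rpow_div_log_pow hs (fun x hx =>
    ((hgS x hx).sub (hgM x hx)).congr (g := fun t => g' t * E t) (fun t _ => by
      simp only [hE, mul_sub])) hgE
  have hB : (fun x => g x * E x) =O[atTop] fun x : ℝ =>
      x ^ (s.re + 1) / Real.log x ^ (m + 1) := by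
    have h1 := isBigO_cpow_div_log_pow s 1 k
    refine (h1.mul hEO).congr' (.of_forall fun t => by simp only [hg, mul_one_div]) ?_
    filter_upwards [eventually_gt_atTop 1] with t ht
    have hl := (Real.log_pos ht).ne'
    have ht0 : 0 < t := by linarith
    rw [Real.rpow_add ht0, Real.rpow_one, hk, show 2 * m + 1 = m + (m + 1) by ring, pow_add]
    field_simp
  refine ((hB.sub hI).add (isBigO_const_rpow_div_log_pow (by linarith) (m + 1)
    ((2 : ℂ) ^ s - g 2 * E 2))).congr' ?_ .rfl
  filter_upwards [eventually_ge_atTop 2] with x hx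
  have hsub := uIcc_two_subset_Ioi_one hx
  have habel := sum_mul_eq_sub_sub_integral_mul c (f := g) (a := 2) (b := x) (by norm_num) hx
    (fun t ht => (hgd t (one_lt_two.trans_le ht.1)).differentiableAt)
    ((hg'c.mono fun t ht => one_lt_two.trans_le ht.1).integrableOn_Icc.congr_fun
      (fun t ht => (hgd t (one_lt_two.trans_le ht.1)).deriv.symm) measurableSet_Icc)
  have e1 : ∫ t in Set.Ioc 2 x, deriv g t * ∑ n ∈ Finset.Icc 0 ⌊t⌋₊, c n =
      ∫ t in (2 : ℝ)..x, g' t * S t := by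
    rw [intervalIntegral.integral_of_le hx]
    refine MeasureTheory.setIntegral_congr_fun measurableSet_Ioc fun t ht => ?_
    simp only [hS]
    rw [(hgd t (one_lt_two.trans ht.1)).deriv]
  have e2 := intervalIntegral.integral_mul_deriv_eq_deriv_mul
    (fun t ht => hgd t (hsub ht)) (fun t ht => hMd t (zero_lt_one.trans (hsub ht)))
    (hg'c.mono hsub).intervalIntegrable (ContinuousOn.intervalIntegrable fun t ht =>
      ((Complex.continuous_ofReal.continuousAt.comp (Real.continuousAt_log
        (ne_of_gt (zero_lt_one.trans (hsub ht))))).pow _).continuousWithinAt)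
  have e3 : ∫ t in (2 : ℝ)..x, g t * (Real.log t : ℂ) ^ (2 * m) =
      ∫ t in (2 : ℝ)..x, (t : ℂ) ^ s * (1 / (Real.log t : ℂ)) := by
    refine intervalIntegral.integral_congr fun t ht => ?_
    have hl : (Real.log t : ℂ) ≠ 0 := by exact_mod_cast (Real.log_pos (hsub ht)).ne'
    simp only [hg, hk, pow_succ]
    field_simp
  have e4 : ∫ t in (2 : ℝ)..x, g' t * E t =
      (∫ t in (2 : ℝ)..x, g' t * S t) - ∫ t in (2 : ℝ)..x, g' t * M t := by
    rw [← intervalIntegral.integral_sub (hgS x hx) (hgM x hx)]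
    simp only [hE, mul_sub]
  rw [e1, Nat.floor_ofNat] at habel
  have e5 := piPow_eq_sum_ite s hx k
  have e6 : ∑ n ∈ Finset.Icc 0 2, c n = S 2 := by simp only [hS, Nat.floor_ofNat]
  rw [e6] at habel
  rw [e3] at e2
  rw [e5, e4]
  simp only [hE]
  linear_combination -habel + e2

/-- `f` has the asymptotic expansion `∑ⱼ c j / z ^ (j + 1)` along the filter `l`. -/
def HasInvPowExpansion {α : Type*} (l : Filter α) (z f : α → ℂ) (c : ℕ → ℂ) : Prop :=
  ∀ N : ℕ, (fun x => f x - ∑ j ∈ Finset.range N, c j * (z x ^ (j + 1))⁻¹) =O[l]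
    fun x => (z x ^ (N + 1))⁻¹

namespace HasInvPowExpansion

variable {α : Type*} {l : Filter α} {z f g : α → ℂ} {c d : ℕ → ℂ}

theorem sub (hf : HasInvPowExpansion l z f c) (hg : HasInvPowExpansion l z g d) :
    HasInvPowExpansion l z (fun x => f x - g x) (fun j => c j - d j) := by
  intro N
  refine ((hf N).sub (hg N)).congr_left fun x => ?_
  simp only [sub_mul, Finset.sum_sub_distrib]
  ring

theorem const_mul (a : ℂ) (hf : HasInvPowExpansion l z f c) :
    HasInvPowExpansion l z (fun x => a * f x) (fun j => a * c j) := by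
  intro N
  refine ((hf N).const_mul_left a).congr_left fun x => ?_
  simp only [mul_assoc, ← Finset.mul_sum]
  ring

theorem mul_sub_const (hz : ∀ᶠ x in l, z x ≠ 0) (hf : HasInvPowExpansion l z f c) :
    HasInvPowExpansion l z (fun x => z x * f x - c 0) (fun j => c (j + 1)) := by
  intro N
  refine ((Asymptotics.isBigO_refl z l).mul (hf (N + 1))).congr' ?_ ?_
  · filter_upwards [hz] with x hx
    rw [Finset.sum_range_succ', mul_sub, mul_add, Finset.mul_sum]
    have e : z x * (c 0 * (z x ^ (0 + 1))⁻¹) = c 0 := by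
      field_simp
      ring
    have e2 : ∑ j ∈ Finset.range N, z x * (c (j + 1) * (z x ^ (j + 1 + 1))⁻¹) =
        ∑ j ∈ Finset.range N, c (j + 1) * (z x ^ (j + 1))⁻¹ :=
      Finset.sum_congr rfl fun j _ => by
        field_simp
        ring
    rw [e, e2]
    ring
  · filter_upwards [hz] with x hx
    field_simp
    ring

theorem tendsto_pow_mul (hz : Tendsto z l (Bornology.cobounded ℂ))
    (hf : HasInvPowExpansion l z f c) {n : ℕ} (hc : ∀ j < n, c j = 0) :
    Tendsto (fun x => z x ^ (n + 1) * f x) l (nhds (c n)) := by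
  have hne : ∀ᶠ x in l, z x ≠ 0 := hz.eventually (Bornology.eventually_ne_cobounded 0)
  have h0 : Tendsto (fun x => (z x)⁻¹) l (nhds 0) := tendsto_inv₀_cobounded.comp hz
  have h1 : (fun x => z x ^ (n + 1) * f x - c n) =O[l] fun x => (z x)⁻¹ := by
    refine ((Asymptotics.isBigO_refl (fun x => z x ^ (n + 1)) l).mul (hf (n + 1))).congr' ?_ ?_
    · filter_upwards [hne] with x hx
      rw [Finset.sum_range_succ, Finset.sum_eq_zero fun j hj => by
        rw [hc j (Finset.mem_range.1 hj), zero_mul]]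
      field_simp
      ring
    · filter_upwards [hne] with x hx
      field_simp
      ring
  simpa using (h1.trans_tendsto h0).add_const (c n)

end HasInvPowExpansion

/-- The partial numerators `1, 1, 4, 9, …` of the continued fraction, indexed from `1`. -/
noncomputable def cfNumerator (j : ℕ) : ℂ := if j = 1 then 1 else ((j : ℂ) - 1) ^ 2

/-- The remainders of the continued fraction for `f`: the successive ratios
`cfRemainder z f (j + 1) / cfRemainder z f j` are its tails. -/
noncomputable def cfRemainder (z f : ℂ) : ℕ → ℂ
  | 0 => 1
  | 1 => f
  | n + 2 => (z - (2 * ((n + 1 : ℕ) : ℂ) - 1)) * cfRemainder z f (n + 1) -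
      cfNumerator (n + 1) * cfRemainder z f n

theorem cfNumerator_ne_zero (j : ℕ) : cfNumerator (j + 1) ≠ 0 := by
  rw [cfNumerator]
  split_ifs with h
  · exact one_ne_zero
  · have : (j : ℂ) ≠ 0 := by
      rw [Nat.cast_ne_zero]
      omega
    push_cast
    simpa using this

theorem prod_range_cfNumerator (n : ℕ) :
    ∏ i ∈ Finset.range (n + 1), cfNumerator (i + 1) = (n.factorial : ℂ) ^ 2 := by
  induction n with
  | zero => simp [cfNumerator]
  | succ n ih =>
    rw [Finset.prod_range_succ, ih, cfNumerator, if_neg (by omega), Nat.factorial_succ]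
    push_cast
    ring

theorem factorial_mul_descFactorial_recurrence (n m : ℕ) :
    ((m + 1).factorial * (m + 1).descFactorial (n + 1) : ℂ) -
      (2 * ((n + 2 : ℕ) : ℂ) - 1) * (m.factorial * m.descFactorial (n + 1)) -
        ((n : ℂ) + 1) ^ 2 * (m.factorial * m.descFactorial n) =
      m.factorial * m.descFactorial (n + 2) := by
  have h1 : (m.descFactorial (n + 1) : ℂ) = (m - n) * m.descFactorial n := by
    rcases le_or_gt n m with h | h
    · rw [Nat.descFactorial_succ]
      push_cast [h]
      rfl
    · rw [Nat.descFactorial_of_lt h, Nat.descFactorial_of_lt (by omega)]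
      simp
  have h2 : (m.descFactorial (n + 2) : ℂ) = (m - (n + 1)) * m.descFactorial (n + 1) := by
    rcases le_or_gt (n + 1) m with h | h
    · rw [Nat.descFactorial_succ]
      push_cast [h]
      rfl
    · rw [Nat.descFactorial_of_lt h, Nat.descFactorial_of_lt (by omega)]
      simp
  rw [h2, h1, Nat.succ_descFactorial_succ, Nat.factorial_succ]
  push_cast
  ring

section ContinuedFraction

variable {α : Type*} {l : Filter α} {z f : α → ℂ}

theorem hasInvPowExpansion_cfRemainder (hz : ∀ᶠ x in l, z x ≠ 0)
    (hf : HasInvPowExpansion l z f fun j => (j.factorial : ℂ)) (n : ℕ) :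
    HasInvPowExpansion l z (fun x => cfRemainder (z x) (f x) (n + 1))
      fun m => (m.factorial * m.descFactorial n : ℂ) := by
  induction n using Nat.twoStepInduction with
  | zero => simpa [cfRemainder] using hf
  | one =>
    have h := (hf.mul_sub_const hz).sub hf
    convert h using 1
    · ext x
      simp only [cfRemainder, cfNumerator]
      simp
      ring
    · ext m
      simp only [Nat.factorial_succ, Nat.descFactorial_one]
      push_cast
      ring
  | more n ih₁ ih₂ =>
    have h := ((ih₂.mul_sub_const hz).sub (ih₂.const_mul (2 * ((n + 2 : ℕ) : ℂ) - 1))).sub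
      (ih₁.const_mul (((n : ℂ) + 1) ^ 2))
    convert h using 1
    · ext x
      rw [cfRemainder, cfNumerator, if_neg (by omega)]
      simp
      ring
    · ext m
      exact (factorial_mul_descFactorial_recurrence n m).symm

theorem tendsto_pow_mul_cfRemainder (hz : Tendsto z l (Bornology.cobounded ℂ))
    (hf : HasInvPowExpansion l z f fun j => (j.factorial : ℂ)) (n : ℕ) :
    Tendsto (fun x => z x ^ n * cfRemainder (z x) (f x) n) l
      (nhds (∏ i ∈ Finset.range n, cfNumerator (i + 1))) := by
  rcases n with _ | n
  · simpa [cfRemainder] using tendsto_const_nhds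
  · rw [prod_range_cfNumerator]
    have h := (hasInvPowExpansion_cfRemainder (hz.eventually (Bornology.eventually_ne_cobounded 0))
      hf n).tendsto_pow_mul hz (n := n) fun j hj => by simp [Nat.descFactorial_of_lt hj]
    rwa [Nat.descFactorial_self, ← sq] at h

theorem eventually_cfRemainder_ne_zero (hz : Tendsto z l (Bornology.cobounded ℂ))
    (hf : HasInvPowExpansion l z f fun j => (j.factorial : ℂ)) (n : ℕ) :
    ∀ᶠ x in l, cfRemainder (z x) (f x) n ≠ 0 := by
  have h := (tendsto_pow_mul_cfRemainder hz hf n).eventually_ne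
    (Finset.prod_ne_zero_iff.2 fun i _ => cfNumerator_ne_zero i)
  filter_upwards [h] with x hx using right_ne_zero_of_mul hx

theorem tendsto_mul_cfRemainder_div (hz : Tendsto z l (Bornology.cobounded ℂ))
    (hf : HasInvPowExpansion l z f fun j => (j.factorial : ℂ)) (n : ℕ) :
    Tendsto (fun x => z x * (cfRemainder (z x) (f x) (n + 1) / cfRemainder (z x) (f x) n)) l
      (nhds (cfNumerator (n + 1))) := by
  have hprod : ∏ i ∈ Finset.range n, cfNumerator (i + 1) ≠ 0 :=
    Finset.prod_ne_zero_iff.2 fun i _ => cfNumerator_ne_zero i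
  have h := (tendsto_pow_mul_cfRemainder hz hf (n + 1)).div (tendsto_pow_mul_cfRemainder hz hf n)
    hprod
  rw [Finset.prod_range_succ, mul_div_cancel_left₀ _ hprod] at h
  refine h.congr' ?_
  filter_upwards [hz.eventually (Bornology.eventually_ne_cobounded 0)] with x hx
  simp only [Pi.div_apply]
  rw [pow_succ]
  field_simp

theorem tendsto_pow_mul_cfRemainder_div_sub (hz : Tendsto z l (Bornology.cobounded ℂ))
    (hf : HasInvPowExpansion l z f fun j => (j.factorial : ℂ)) (n j : ℕ) :
    Tendsto (fun x => z x ^ (2 * n + 1) *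
      (cfRemainder (z x) (f x) (j + 1) / cfRemainder (z x) (f x) j -
        cfApproxC cfNumerator (fun i => z x - (2 * (i : ℂ) - 1)) (j + 1) n)) l
      (nhds (∏ i ∈ Finset.range (n + 1), cfNumerator (j + i + 1))) := by
  induction n generalizing j with
  | zero => simpa [cfApproxC] using tendsto_mul_cfRemainder_div hz hf j
  | succ n ih =>
    have hne : ∀ᶠ x in l, z x ≠ 0 := hz.eventually (Bornology.eventually_ne_cobounded 0)
    have h0 : Tendsto (fun x => (z x)⁻¹) l (nhds 0) := tendsto_inv₀_cobounded.comp hz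
    set G : α → ℂ := fun x =>
      cfRemainder (z x) (f x) (j + 1 + 1) / cfRemainder (z x) (f x) (j + 1) with hG
    set W : α → ℂ := fun x =>
      cfApproxC cfNumerator (fun i => z x - (2 * (i : ℂ) - 1)) (j + 1 + 1) n with hW
    have hG0 : Tendsto G l (nhds 0) := by
      have h := h0.mul (tendsto_mul_cfRemainder_div hz hf (j + 1))
      rw [zero_mul] at h
      refine h.congr' ?_
      filter_upwards [hne] with x hx using inv_mul_cancel_left₀ hx _
    have hW0 : Tendsto W l (nhds 0) := by
      have h := hG0.sub ((h0.pow (2 * n + 1)).mul (ih (j + 1)))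
      rw [zero_pow (by omega), zero_mul, sub_zero] at h
      refine h.congr' ?_
      filter_upwards [hne] with x hx
      rw [inv_pow, inv_mul_cancel_left₀ (pow_ne_zero _ hx), sub_sub_cancel]
    have hquot : ∀ V : α → ℂ, Tendsto V l (nhds 0) → Tendsto (fun x =>
        (z x - (2 * ((j + 1 : ℕ) : ℂ) - 1) - V x) * (z x)⁻¹) l (nhds 1) := by
      intro V hV
      have h := ((tendsto_const_nhds (x := (1 : ℂ))).sub
        (h0.const_mul (2 * ((j + 1 : ℕ) : ℂ) - 1))).sub (hV.mul h0)
      simp only [mul_zero, sub_zero] at h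
      refine h.congr' ?_
      filter_upwards [hne] with x hx
      field_simp
    have hGq := hquot G hG0
    have hWq := hquot W hW0
    have key := ((ih (j + 1)).const_mul (cfNumerator (j + 1))).div (hGq.mul hWq)
      (by norm_num)
    have e : ∏ i ∈ Finset.range (n + 1 + 1), cfNumerator (j + i + 1) =
        cfNumerator (j + 1) * ∏ i ∈ Finset.range (n + 1), cfNumerator (j + 1 + i + 1) := by
      rw [Finset.prod_range_succ', mul_comm]
      simp only [add_zero, add_assoc, add_comm 1]
    rw [mul_one, div_one, ← e] at key
    refine key.congr' ?_
    filter_upwards [hne, hGq.eventually_ne one_ne_zero, hWq.eventually_ne one_ne_zero,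
      eventually_cfRemainder_ne_zero hz hf j, eventually_cfRemainder_ne_zero hz hf (j + 1)]
      with x hx hGx hWx hj hj1
    have hbG := left_ne_zero_of_mul hGx
    have hbW := left_ne_zero_of_mul hWx
    have hratio : cfRemainder (z x) (f x) (j + 1) / cfRemainder (z x) (f x) j =
        cfNumerator (j + 1) / (z x - (2 * ((j + 1 : ℕ) : ℂ) - 1) - G x) := by
      rw [div_eq_div_iff hj hbG]
      have hrec : cfRemainder (z x) (f x) (j + 1 + 1) =
          (z x - (2 * ((j + 1 : ℕ) : ℂ) - 1)) * cfRemainder (z x) (f x) (j + 1) -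
            cfNumerator (j + 1) * cfRemainder (z x) (f x) j := rfl
      have hGmul : G x * cfRemainder (z x) (f x) (j + 1) =
          cfRemainder (z x) (f x) (j + 1 + 1) := div_mul_cancel₀ _ hj1
      linear_combination -hGmul - hrec
    have hW' : cfApproxC cfNumerator (fun i => z x - (2 * (i : ℂ) - 1)) (j + 1) (n + 1) =
        cfNumerator (j + 1) / (z x - (2 * ((j + 1 : ℕ) : ℂ) - 1) - W x) := rfl
    rw [hratio, hW']
    change cfNumerator (j + 1) * (z x ^ (2 * n + 1) * (G x - W x)) /
      ((z x - (2 * ((j + 1 : ℕ) : ℂ) - 1) - G x) * (z x)⁻¹ *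
        ((z x - (2 * ((j + 1 : ℕ) : ℂ) - 1) - W x) * (z x)⁻¹)) = _
    generalize z x - (2 * ((j + 1 : ℕ) : ℂ) - 1) = b at hbG hbW ⊢
    field_simp
    ring

end ContinuedFraction

theorem tendsto_mul_log_cobounded {w : ℂ} (hw : w ≠ 0) :
    Tendsto (fun x : ℝ => w * (Real.log x : ℂ)) atTop (Bornology.cobounded ℂ) := by
  rw [← tendsto_norm_atTop_iff_cobounded]
  simp only [norm_mul, Complex.norm_real]
  exact (tendsto_norm_atTop_atTop.comp Real.tendsto_log_atTop).const_mul_atTop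
    (norm_pos_iff.2 hw)

theorem hasInvPowExpansion_piPow {s : ℂ} (hs : -1 < s.re) :
    HasInvPowExpansion atTop (fun x : ℝ => (s + 1) * (Real.log x : ℂ))
      (fun x : ℝ => Complex.exp (-((s + 1) * (Real.log x : ℂ))) * piPow s x)
      fun j => (j.factorial : ℂ) := by
  intro N
  have hw : s + 1 ≠ 0 := fun h => by
    have := congrArg Complex.re h
    simp at this
    linarith
  have h := (Asymptotics.isBigO_refl (fun x : ℝ =>
    Complex.exp (-((s + 1) * (Real.log x : ℂ)))) atTop).norm_right.mul
      ((piPow_sub_integral_isBigO hs N).add (isBigO_integral_cpow_div_log_sub hs N))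
  refine (h.congr' (f₂ := fun x : ℝ => Complex.exp (-((s + 1) * (Real.log x : ℂ))) * piPow s x -
    ∑ j ∈ Finset.range N, (j.factorial : ℂ) * (((s + 1) * (Real.log x : ℂ)) ^ (j + 1))⁻¹)
    ?_ EventuallyEq.rfl).trans ?_
  · filter_upwards [eventually_gt_atTop 0] with x hx
    have hexp : Complex.exp (-((s + 1) * (Real.log x : ℂ))) * (x : ℂ) ^ (s + 1) = 1 := by
      rw [Complex.cpow_def_of_ne_zero (by exact_mod_cast hx.ne'), ← Complex.ofReal_log hx.le,
        ← Complex.exp_add, mul_comm (s + 1), neg_add_cancel, Complex.exp_zero]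
    rw [sub_add_sub_cancel, mul_sub, Finset.mul_sum]
    congr 1
    refine Finset.sum_congr rfl fun j _ => ?_
    rw [mul_pow, mul_inv]
    linear_combination (j.factorial : ℂ) / (s + 1) ^ (j + 1) / (Real.log x : ℂ) ^ (j + 1) * hexp
  · refine Asymptotics.IsBigO.of_bound (‖s + 1‖ ^ (N + 1)) ?_
    filter_upwards [eventually_gt_atTop 1] with x hx
    have hx0 : 0 < x := by linarith
    have hexp : ‖Complex.exp (-((s + 1) * (Real.log x : ℂ)))‖ * x ^ (s.re + 1) = 1 := by
      rw [Complex.norm_exp, Real.rpow_def_of_pos hx0, ← Real.exp_add]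
      simp [mul_comm]
    have hL : 0 < Real.log x := Real.log_pos hx
    have hwn : ‖s + 1‖ ≠ 0 := norm_ne_zero_iff.2 hw
    have hpos : 0 < x ^ (s.re + 1) := Real.rpow_pos_of_pos hx0 _
    rw [norm_mul, norm_norm, norm_inv, norm_pow, norm_mul, Complex.norm_real,
      Real.norm_of_nonneg hL.le, Real.norm_of_nonneg (by positivity), mul_div_assoc', hexp, mul_pow,
      mul_inv, mul_inv_cancel_left₀ (pow_ne_zero _ hwn), one_div]

/-- Let `s ∈ ℂ` with `Re(s) > −1`, and let `w_n(z)` be the `n`-th approximant of the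
continued fraction with partial numerators `a₁ = 1`, `a_j = (j−1)²` for `j ≥ 2`, and partial
denominators `b_j = z − (2j−1)`.  Then for every `n ≥ 0`,
`x^{−(s+1)}·∑_{p ≤ x} p^s − w_n((s+1)·log x) ∼ (n!)²/((s+1)·log x)^{2n+1}` as `x → ∞`. -/
theorem piPow_cf_approximant_asymptotics (s : ℂ) (hs : -1 < s.re) (n : ℕ) :
    Tendsto (fun x : ℝ =>
        (Complex.exp (-((s + 1) * (Real.log x : ℂ))) * piPow s x
            - cfApproxC (fun j => if j = 1 then 1 else ((j : ℂ) - 1) ^ 2)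
                (fun j => (s + 1) * (Real.log x : ℂ) - (2 * (j : ℂ) - 1)) 1 n)
          / ((Nat.factorial n : ℂ) ^ 2 / ((s + 1) * (Real.log x : ℂ)) ^ (2 * n + 1)))
      atTop (nhds 1) := by
  have hw : s + 1 ≠ 0 := fun h => by
    have := congrArg Complex.re h
    simp at this
    linarith
  have hn : (n.factorial : ℂ) ^ 2 ≠ 0 := pow_ne_zero _ (Nat.cast_ne_zero.2 n.factorial_ne_zero)
  have h := (tendsto_pow_mul_cfRemainder_div_sub (tendsto_mul_log_cobounded hw)
    (hasInvPowExpansion_piPow hs) n 0).div_const ((n.factorial : ℂ) ^ 2)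
  simp only [zero_add, prod_range_cfNumerator, cfRemainder, div_one] at h
  rw [div_self hn] at h
  refine h.congr fun x => ?_
  rw [div_div_eq_mul_div, mul_comm]
  rfl
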